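/- arXiv:1811.01350 — 2 statements merged into one kernel-verified Lean document; each statement's English description precedes it below -/
import Mathlib

section
/- Let δ ≥ 0, let a ∈ ℝ^d, let k ∈ ℕ^d be a multi-index, and let f = (f_1,…,f_d) and g = (g_1,…,g_d) be d-tuples of coefficient families ℤ^d → ℂ with |f|_δ, |g|_δ, |Df|_δ, |Dg|_δ < ∞. Then, writing h := (ã+f)^k − (ã+g)^k, one has ‖Dh‖_δ ≤ (max_i ‖f_i − g_i‖_δ) · max(|Df|_δ, |Dg|_δ) · |k|(|k|−1) · ( |a|_∞ + max(|f|_δ,|g|_δ) )^{|k|−2} + (max_i ‖D(f_i − g_i)‖_δ) · |k| · ( |a|_∞ + max(|f|_δ,|g|_δ) )^{|k|−1}. -/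
open ENNReal

noncomputable section

/-- Euclidean norm of an integer vector `n ∈ ℤ^d ⊂ ℝ^d`. -/
def znorm {d : ℕ} (n : Fin d → ℤ) : ℝ := Real.sqrt (∑ j, ((n j : ℝ)) ^ 2)

/-- The weighted analytic norm `‖u‖_δ = Σ_n ‖u_n‖ e^{δ|n|} ∈ [0,∞]` of a
coefficient family `u : ℤ^d → B`. -/
def anorm {d : ℕ} {B : Type*} [NormedAddCommGroup B] (δ : ℝ)
    (u : (Fin d → ℤ) → B) : ℝ≥0∞ :=
  ∑' n : Fin d → ℤ, (‖u n‖₊ : ℝ≥0∞) * ENNReal.ofReal (Real.exp (δ * znorm n))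

/-- The weighted analytic norm of the derivative,
`‖Du‖_δ = Σ_n |n|·‖u_n‖ e^{δ|n|} ∈ [0,∞]`. -/
def dnorm {d : ℕ} {B : Type*} [NormedAddCommGroup B] (δ : ℝ)
    (u : (Fin d → ℤ) → B) : ℝ≥0∞ :=
  ∑' n : Fin d → ℤ,
    ENNReal.ofReal (znorm n) * (‖u n‖₊ : ℝ≥0∞) * ENNReal.ofReal (Real.exp (δ * znorm n))

/-- The unit coefficient family: `1` at frequency `0`, `0` elsewhere. -/
def convOne (d : ℕ) : (Fin d → ℤ) → ℂ := fun n => if n = 0 then 1 else 0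

/-- Convolution of two coefficient families: `(u*v)_n = Σ_{k+l=n} u_k v_l`. -/
def conv {d : ℕ} (u v : (Fin d → ℤ) → ℂ) : (Fin d → ℤ) → ℂ :=
  fun n => ∑' k : Fin d → ℤ, u k * v (n - k)

/-- Convolution powers of a coefficient family. -/
def convPow {d : ℕ} (u : (Fin d → ℤ) → ℂ) : ℕ → (Fin d → ℤ) → ℂ
  | 0 => convOne d
  | m + 1 => conv u (convPow u m)

/-- The convolution product `Π_{i} F_i^{*k_i}` of a `d`-tuple of coefficient
families raised to the multi-index `k`. -/
def convProd {d : ℕ} (F : Fin d → (Fin d → ℤ) → ℂ) (k : Fin d → ℕ) :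
    (Fin d → ℤ) → ℂ :=
  ((List.finRange d).map fun i => convPow (F i) (k i)).foldr conv (convOne d)

/-- The coefficient family of the constant `a ∈ ℝ^d`: the `i`-th family equals
`a_i` at frequency `0` and vanishes elsewhere. -/
def constFam {d : ℕ} (a : Fin d → ℝ) : Fin d → (Fin d → ℤ) → ℂ :=
  fun i n => if n = 0 then (a i : ℂ) else 0

lemma znorm_eq_norm_toLp {d : ℕ} (n : Fin d → ℤ) :
    znorm n = ‖WithLp.toLp 2 (fun j => (n j : ℝ))‖ := by
  simp [znorm, EuclideanSpace.norm_eq]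

lemma znorm_nonneg {d : ℕ} (n : Fin d → ℤ) : 0 ≤ znorm n := Real.sqrt_nonneg _

lemma znorm_zero {d : ℕ} : znorm (0 : Fin d → ℤ) = 0 := by simp [znorm]

lemma znorm_add_le {d : ℕ} (k l : Fin d → ℤ) : znorm (k + l) ≤ znorm k + znorm l := by
  simp only [znorm_eq_norm_toLp]
  refine le_trans (le_of_eq ?_) (norm_add_le _ _)
  congr 1
  ext j
  simp

/-- The weighted `ℓ¹` norm of a coefficient family. -/
def wsum {d : ℕ} (w : (Fin d → ℤ) → ℝ≥0∞) (u : (Fin d → ℤ) → ℂ) : ℝ≥0∞ :=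
  ∑' n, ‖u n‖ₑ * w n

/-- The exponential weight `e^{δ|n|}`. -/
def expWeight {d : ℕ} (δ : ℝ) (n : Fin d → ℤ) : ℝ≥0∞ :=
  ENNReal.ofReal (Real.exp (δ * znorm n))

/-- The weight `|n| e^{δ|n|}`. -/
def derivWeight {d : ℕ} (δ : ℝ) (n : Fin d → ℤ) : ℝ≥0∞ :=
  ENNReal.ofReal (znorm n) * expWeight δ n

lemma anorm_eq_wsum {d : ℕ} (δ : ℝ) (u : (Fin d → ℤ) → ℂ) :
    anorm δ u = wsum (expWeight δ) u := rfl

lemma dnorm_eq_wsum {d : ℕ} (δ : ℝ) (u : (Fin d → ℤ) → ℂ) :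
    dnorm δ u = wsum (derivWeight δ) u := by
  refine tsum_congr fun n => ?_
  simp only [derivWeight, expWeight, enorm_eq_nnnorm]
  ring

lemma expWeight_zero {d : ℕ} (δ : ℝ) : expWeight δ (0 : Fin d → ℤ) = 1 := by
  simp [expWeight, znorm_zero]

lemma derivWeight_zero {d : ℕ} (δ : ℝ) : derivWeight δ (0 : Fin d → ℤ) = 0 := by
  simp [derivWeight, znorm_zero]

lemma one_le_expWeight {d : ℕ} {δ : ℝ} (hδ : 0 ≤ δ) (n : Fin d → ℤ) : 1 ≤ expWeight δ n :=
  ENNReal.one_le_ofReal.2 (Real.one_le_exp (mul_nonneg hδ (znorm_nonneg n)))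

lemma expWeight_add_le {d : ℕ} {δ : ℝ} (hδ : 0 ≤ δ) (k l : Fin d → ℤ) :
    expWeight δ (k + l) ≤ expWeight δ k * expWeight δ l := by
  rw [expWeight, expWeight, expWeight, ← ENNReal.ofReal_mul (Real.exp_nonneg _), ← Real.exp_add,
    ← mul_add]
  gcongr
  exact znorm_add_le k l

lemma derivWeight_add_le {d : ℕ} {δ : ℝ} (hδ : 0 ≤ δ) (k l : Fin d → ℤ) :
    derivWeight δ (k + l) ≤ derivWeight δ k * expWeight δ l + expWeight δ k * derivWeight δ l := by
  calc derivWeight δ (k + l)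
      ≤ (ENNReal.ofReal (znorm k) + ENNReal.ofReal (znorm l))
          * (expWeight δ k * expWeight δ l) := by
        refine mul_le_mul' ?_ (expWeight_add_le hδ k l)
        rw [← ENNReal.ofReal_add (znorm_nonneg k) (znorm_nonneg l)]
        exact ENNReal.ofReal_le_ofReal (znorm_add_le k l)
    _ = _ := by simp only [derivWeight]; ring

lemma wsum_add_le {d : ℕ} (w : (Fin d → ℤ) → ℝ≥0∞) (u v : (Fin d → ℤ) → ℂ) :
    wsum w (u + v) ≤ wsum w u + wsum w v := by
  rw [wsum, wsum, wsum, ← ENNReal.tsum_add]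
  refine ENNReal.tsum_le_tsum fun n => ?_
  rw [← add_mul]
  gcongr
  exact enorm_add_le _ _

lemma wsum_eq_of_support {d : ℕ} (w : (Fin d → ℤ) → ℝ≥0∞) {u : (Fin d → ℤ) → ℂ}
    (hu : ∀ n, n ≠ 0 → u n = 0) : wsum w u = ‖u 0‖ₑ * w 0 :=
  tsum_eq_single 0 fun n hn => by simp [hu n hn]

/-- A convolution inequality for weighted `ℓ¹` norms, in product-rule form. -/
lemma wsum_conv_le {d : ℕ} {w w₁ w₂ w₃ w₄ : (Fin d → ℤ) → ℝ≥0∞}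
    (hw : ∀ k l, w (k + l) ≤ w₁ k * w₂ l + w₃ k * w₄ l) (u v : (Fin d → ℤ) → ℂ) :
    wsum w (conv u v) ≤ wsum w₁ u * wsum w₂ v + wsum w₃ u * wsum w₄ v := by
  have key (x y : (Fin d → ℤ) → ℝ≥0∞) : wsum x u * wsum y v
      = ∑' k, ∑' l, ‖u k‖ₑ * x k * (‖v l‖ₑ * y l) := by
    simp only [wsum, ENNReal.tsum_mul_left, ENNReal.tsum_mul_right]
  calc wsum w (conv u v) ≤ ∑' n, ∑' k, ‖u k‖ₑ * ‖v (n - k)‖ₑ * w n := by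
        refine ENNReal.tsum_le_tsum fun n => ?_
        rw [ENNReal.tsum_mul_right]
        gcongr
        simp only [← enorm_mul]
        exact enorm_tsum_le_tsum_enorm
    _ = ∑' k, ∑' l, ‖u k‖ₑ * ‖v l‖ₑ * w (k + l) := by
        rw [ENNReal.tsum_comm]
        refine tsum_congr fun k => ?_
        rw [← (Equiv.addLeft k).tsum_eq]
        simp
    _ ≤ ∑' k, ∑' l, (‖u k‖ₑ * w₁ k * (‖v l‖ₑ * w₂ l) + ‖u k‖ₑ * w₃ k * (‖v l‖ₑ * w₄ l)) := by
        refine ENNReal.tsum_le_tsum fun k => ENNReal.tsum_le_tsum fun l => ?_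
        refine (mul_le_mul_right (hw k l) _).trans (le_of_eq ?_)
        ring
    _ = _ := by simp only [ENNReal.tsum_add, key]

lemma anorm_conv_le {d : ℕ} {δ : ℝ} (hδ : 0 ≤ δ) (u v : (Fin d → ℤ) → ℂ) :
    anorm δ (conv u v) ≤ anorm δ u * anorm δ v := by
  have h := wsum_conv_le (w := expWeight δ) (w₁ := expWeight δ) (w₂ := expWeight δ) (w₃ := 0)
    (w₄ := 0) (fun k l => by simpa using expWeight_add_le hδ k l) u v
  simpa [anorm_eq_wsum, wsum] using h

lemma dnorm_conv_le {d : ℕ} {δ : ℝ} (hδ : 0 ≤ δ) (u v : (Fin d → ℤ) → ℂ) :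
    dnorm δ (conv u v) ≤ dnorm δ u * anorm δ v + anorm δ u * dnorm δ v := by
  simp only [anorm_eq_wsum, dnorm_eq_wsum]
  exact wsum_conv_le (derivWeight_add_le hδ) u v

lemma anorm_add_le {d : ℕ} (δ : ℝ) (u v : (Fin d → ℤ) → ℂ) :
    anorm δ (u + v) ≤ anorm δ u + anorm δ v := wsum_add_le _ u v

lemma dnorm_add_le {d : ℕ} (δ : ℝ) (u v : (Fin d → ℤ) → ℂ) :
    dnorm δ (u + v) ≤ dnorm δ u + dnorm δ v := by
  simpa only [dnorm_eq_wsum] using wsum_add_le _ u v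

lemma summable_norm_of_anorm_ne_top {d : ℕ} {δ : ℝ} (hδ : 0 ≤ δ) {u : (Fin d → ℤ) → ℂ}
    (hu : anorm δ u ≠ ⊤) : Summable fun n => ‖u n‖ := by
  have h : ∑' n, ‖u n‖ₑ ≠ ⊤ := ne_top_of_le_ne_top hu <|
    ENNReal.tsum_le_tsum fun n => le_mul_of_one_le_right' (one_le_expWeight hδ n)
  simpa using ENNReal.summable_toReal h

lemma summable_conv_term {d : ℕ} {δ : ℝ} (hδ : 0 ≤ δ) {u v : (Fin d → ℤ) → ℂ}
    (hu : anorm δ u ≠ ⊤) (hv : anorm δ v ≠ ⊤) (n : Fin d → ℤ) :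
    Summable fun k => u k * v (n - k) := by
  have hu' := summable_norm_of_anorm_ne_top hδ hu
  have hv' := summable_norm_of_anorm_ne_top hδ hv
  refine Summable.of_norm_bounded (hu'.mul_right (∑' l, ‖v l‖)) fun k => ?_
  rw [norm_mul]
  gcongr
  exact hv'.le_tsum (n - k) fun _ _ => norm_nonneg _

lemma conv_sub_conv {d : ℕ} {δ : ℝ} (hδ : 0 ≤ δ) {u v u' v' : (Fin d → ℤ) → ℂ}
    (hu : anorm δ u ≠ ⊤) (hv : anorm δ v ≠ ⊤) (hu' : anorm δ u' ≠ ⊤) (hv' : anorm δ v' ≠ ⊤) :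
    conv u u' - conv v v' = conv (u - v) u' + conv v (u' - v') := by
  funext n
  have h₁ := summable_conv_term hδ hu hu' n
  have h₂ := summable_conv_term hδ hv hu' n
  have h₃ := summable_conv_term hδ hv hv' n
  simp only [conv, Pi.sub_apply, Pi.add_apply, sub_mul, mul_sub, h₁.tsum_sub h₂, h₂.tsum_sub h₃]
  ring

/-- Bounds on a pair of families of homogeneity degree `m` and on their difference, where `M`
bounds the factors, `D` their derivatives, `E` the differences of the factors and `E'` the
derivatives of these differences. -/
structure DiffBound {d : ℕ} (δ : ℝ) (M D E E' : ℝ≥0∞) (m : ℕ) (u v : (Fin d → ℤ) → ℂ) :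
    Prop where
  anorm_left : anorm δ u ≤ M ^ m
  anorm_right : anorm δ v ≤ M ^ m
  dnorm_left : dnorm δ u ≤ m * D * M ^ (m - 1)
  dnorm_right : dnorm δ v ≤ m * D * M ^ (m - 1)
  anorm_sub : anorm δ (u - v) ≤ m * E * M ^ (m - 1)
  dnorm_sub : dnorm δ (u - v)
    ≤ E * D * m * (m - 1 : ℕ) * M ^ (m - 2) + E' * m * M ^ (m - 1)

namespace DiffBound

variable {d : ℕ} {δ : ℝ} {M D E E' : ℝ≥0∞} {m m' : ℕ} {u v u' v' : (Fin d → ℤ) → ℂ}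

lemma one : DiffBound δ M D E E' 0 (convOne d) (convOne d) := by
  have ha : anorm δ (convOne d) = 1 := by
    rw [anorm_eq_wsum, wsum_eq_of_support _ fun n hn => by simp [convOne, hn]]
    simp [convOne, expWeight_zero]
  have hd : dnorm δ (convOne d) = 0 := by
    rw [dnorm_eq_wsum, wsum_eq_of_support _ fun n hn => by simp [convOne, hn]]
    simp [derivWeight_zero]
  constructor <;> simp [ha, hd] <;> simp [anorm, dnorm]

lemma natCast_mul_pow_pred_mul_pow (M : ℝ≥0∞) (m m' : ℕ) :
    (m : ℝ≥0∞) * M ^ (m - 1) * M ^ m' = m * M ^ (m + m' - 1) := by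
  rcases m with _ | m
  · simp
  · rw [mul_assoc, ← pow_add]
    congr 2
    omega

lemma conv (hδ : 0 ≤ δ) (hM : M ≠ ⊤) (h : DiffBound δ M D E E' m u v)
    (h' : DiffBound δ M D E E' m' u' v') :
    DiffBound δ M D E E' (m + m') (conv u u') (conv v v') := by
  have fin {w : (Fin d → ℤ) → ℂ} {j : ℕ} (hw : anorm δ w ≤ M ^ j) : anorm δ w ≠ ⊤ :=
    ne_top_of_le_ne_top (ENNReal.pow_ne_top hM) hw
  have hsub := conv_sub_conv hδ (fin h.anorm_left) (fin h.anorm_right) (fin h'.anorm_left)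
    (fin h'.anorm_right)
  have e₁ := natCast_mul_pow_pred_mul_pow M m m'
  have e₂ := natCast_mul_pow_pred_mul_pow M m' m
  rw [add_comm m' m] at e₂
  have first (X : ℝ≥0∞) : m * X * M ^ (m - 1) * M ^ m' + M ^ m * (m' * X * M ^ (m' - 1))
      = ((m + m' : ℕ) : ℝ≥0∞) * X * M ^ (m + m' - 1) := by
    calc _ = X * (m * M ^ (m - 1) * M ^ m') + X * (m' * M ^ (m' - 1) * M ^ m) := by ring
      _ = _ := by rw [e₁, e₂]; push_cast; ring
  refine ⟨?_, ?_, ?_, ?_, ?_, ?_⟩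
  · rw [pow_add]
    exact (anorm_conv_le hδ _ _).trans (mul_le_mul' h.anorm_left h'.anorm_left)
  · rw [pow_add]
    exact (anorm_conv_le hδ _ _).trans (mul_le_mul' h.anorm_right h'.anorm_right)
  · rw [← first]
    exact (dnorm_conv_le hδ _ _).trans (add_le_add (mul_le_mul' h.dnorm_left h'.anorm_left)
      (mul_le_mul' h.anorm_left h'.dnorm_left))
  · rw [← first]
    exact (dnorm_conv_le hδ _ _).trans (add_le_add (mul_le_mul' h.dnorm_right h'.anorm_right)
      (mul_le_mul' h.anorm_right h'.dnorm_right))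
  · rw [hsub, ← first]
    exact (anorm_add_le δ _ _).trans (add_le_add
      ((anorm_conv_le hδ _ _).trans (mul_le_mul' h.anorm_sub h'.anorm_left))
      ((anorm_conv_le hδ _ _).trans (mul_le_mul' h.anorm_right h'.anorm_sub)))
  · rw [hsub]
    refine (dnorm_add_le δ _ _).trans ((add_le_add
      ((dnorm_conv_le hδ _ _).trans (add_le_add (mul_le_mul' h.dnorm_sub h'.anorm_left)
        (mul_le_mul' h.anorm_sub h'.dnorm_left)))
      ((dnorm_conv_le hδ _ _).trans (add_le_add (mul_le_mul' h.dnorm_right h'.anorm_sub)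
        (mul_le_mul' h.anorm_right h'.dnorm_sub)))).trans (le_of_eq ?_))
    rcases m with _ | _ | m <;> rcases m' with _ | _ | m' <;>
      simp [← add_assoc, add_right_comm _ 1] <;> ring

lemma convPow (hδ : 0 ≤ δ) (hM : M ≠ ⊤) (h : DiffBound δ M D E E' 1 u v) :
    ∀ m, DiffBound δ M D E E' m (convPow u m) (convPow v m)
  | 0 => one
  | m + 1 => by
    have := h.conv hδ hM (convPow hδ hM h m)
    rwa [add_comm 1 m] at this

lemma foldr_conv {ι : Type*} (hδ : 0 ≤ δ) (hM : M ≠ ⊤) {k : ι → ℕ}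
    {F G : ι → (Fin d → ℤ) → ℂ} (h : ∀ i, DiffBound δ M D E E' (k i) (F i) (G i)) (l : List ι) :
    DiffBound δ M D E E' (l.map k).sum ((l.map F).foldr _root_.conv (convOne d))
      ((l.map G).foldr _root_.conv (convOne d)) := by
  induction l with
  | nil => exact one
  | cons i l ih => simpa using (h i).conv hδ hM ih

lemma convProd (hδ : 0 ≤ δ) (hM : M ≠ ⊤) {F G : Fin d → (Fin d → ℤ) → ℂ}
    (h : ∀ i, DiffBound δ M D E E' 1 (F i) (G i)) (k : Fin d → ℕ) :
    DiffBound δ M D E E' (∑ i, k i) (convProd F k) (convProd G k) := by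
  have := foldr_conv hδ hM (fun i => (h i).convPow hδ hM (k i)) (List.finRange d)
  rwa [← List.ofFn_eq_map, List.sum_ofFn] at this

end DiffBound

lemma anorm_constFam {d : ℕ} (δ : ℝ) (a : Fin d → ℝ) (i : Fin d) :
    anorm δ (constFam a i) = ‖a i‖₊ := by
  rw [anorm_eq_wsum, wsum_eq_of_support _ fun n hn => by simp [constFam, hn]]
  simp [constFam, expWeight_zero, enorm_eq_nnnorm]

lemma dnorm_constFam {d : ℕ} (δ : ℝ) (a : Fin d → ℝ) (i : Fin d) :
    dnorm δ (constFam a i) = 0 := by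
  rw [dnorm_eq_wsum, wsum_eq_of_support _ fun n hn => by simp [constFam, hn]]
  simp [derivWeight_zero]

/-- Derivative estimate for differences of monomials `Φ(w) = w^k` in analytic
norms: with `h = (ã+f)^k − (ã+g)^k`,
`‖Dh‖_δ ≤ max_i‖f_i−g_i‖_δ · max(|Df|_δ,|Dg|_δ) · |k|(|k|−1) · (|a|_∞+max(|f|_δ,|g|_δ))^{|k|−2}
          + max_i‖D(f_i−g_i)‖_δ · |k| · (|a|_∞+max(|f|_δ,|g|_δ))^{|k|−1}`. -/
theorem stmt_14 (d : ℕ) (δ : ℝ) (hδ : 0 ≤ δ) (a : Fin d → ℝ) (k : Fin d → ℕ)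
    (f g : Fin d → (Fin d → ℤ) → ℂ)
    (hf : ∀ i, anorm δ (f i) ≠ ⊤) (hg : ∀ i, anorm δ (g i) ≠ ⊤)
    (hDf : ∀ i, dnorm δ (f i) ≠ ⊤) (hDg : ∀ i, dnorm δ (g i) ≠ ⊤) :
    dnorm δ (fun n =>
        convProd (fun i => constFam a i + f i) k n
          - convProd (fun i => constFam a i + g i) k n)
      ≤ (⨆ i, anorm δ (f i - g i))
          * max (⨆ i, dnorm δ (f i)) (⨆ i, dnorm δ (g i))
          * ((∑ i, k i : ℕ) : ℝ≥0∞) * (((∑ i, k i) - 1 : ℕ) : ℝ≥0∞)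
          * ((⨆ i, (‖a i‖₊ : ℝ≥0∞)) + max (⨆ i, anorm δ (f i)) (⨆ i, anorm δ (g i)))
              ^ ((∑ i, k i) - 2)
        + (⨆ i, dnorm δ (f i - g i))
          * ((∑ i, k i : ℕ) : ℝ≥0∞)
          * ((⨆ i, (‖a i‖₊ : ℝ≥0∞)) + max (⨆ i, anorm δ (f i)) (⨆ i, anorm δ (g i)))
              ^ ((∑ i, k i) - 1) := by
  set A := ⨆ i, (‖a i‖₊ : ℝ≥0∞)
  set N := max (⨆ i, anorm δ (f i)) (⨆ i, anorm δ (g i))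
  set D := max (⨆ i, dnorm δ (f i)) (⨆ i, dnorm δ (g i))
  have hM : A + N ≠ ⊤ := ENNReal.add_ne_top.2 ⟨_root_.iSup_ne_top fun _ => ENNReal.coe_ne_top,
    (max_lt (_root_.iSup_ne_top hf).lt_top (_root_.iSup_ne_top hg).lt_top).ne⟩
  have anorm_le {p : (Fin d → ℤ) → ℂ} (i : Fin d) (hp : anorm δ p ≤ N) :
      anorm δ (constFam a i + p) ≤ A + N :=
    (anorm_add_le δ _ _).trans (add_le_add
      ((anorm_constFam δ a i).le.trans (le_iSup (fun i => (‖a i‖₊ : ℝ≥0∞)) i)) hp)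
  have dnorm_le {p : (Fin d → ℤ) → ℂ} (i : Fin d) (hp : dnorm δ p ≤ D) :
      dnorm δ (constFam a i + p) ≤ D :=
    (dnorm_add_le δ _ _).trans (by rwa [dnorm_constFam, zero_add])
  refine (DiffBound.convProd hδ hM (fun i => ?_) k).dnorm_sub
  refine ⟨?_, ?_, ?_, ?_, ?_, ?_⟩ <;>
    simp only [add_sub_add_left_eq_sub, pow_one, Nat.cast_one, one_mul, mul_one, tsub_self, pow_zero,
      Nat.cast_zero, mul_zero, zero_mul, zero_add]
  · exact anorm_le i (le_max_of_le_left (le_iSup (fun i => anorm δ (f i)) i))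
  · exact anorm_le i (le_max_of_le_right (le_iSup (fun i => anorm δ (g i)) i))
  · exact dnorm_le i (le_max_of_le_left (le_iSup (fun i => dnorm δ (f i)) i))
  · exact dnorm_le i (le_max_of_le_right (le_iSup (fun i => dnorm δ (g i)) i))
  · exact le_iSup (fun i => anorm δ (f i - g i)) i
  · exact le_iSup (fun i => dnorm δ (f i - g i)) i
end
end

section
/- Assume γ₀ ≥ 0 is such that Λ_n(λ) ≠ i for every n ∈ ℤ^d \ {0} and every λ ∈ ℂ with Re λ > γ₀·|n|, and let γ > γ₀. Then there exists a constant C > 0, independent of δ₀ and of the data, with the following property: let δ₀ > 0 and, for each n ∈ ℤ^d, let (α_n, β_n) be a mild solution of the n-th Fourier mode of the linearized multiphasic system with essentially bounded data (α_n(0,·), β_n(0,·)), and assume Σ_{n∈ℤ^d} max( ‖α_n(0,·)‖_{L^∞(μ)}, ‖β_n(0,·)‖_{L^∞(μ)} )·e^{δ₀|n|} < ∞. Then for every t ∈ [0, δ₀/γ], Σ_{n∈ℤ^d} max( ‖α_n(t,·)‖_{L^∞(μ)}, ‖β_n(t,·)‖_{L^∞(μ)} )·e^{(δ₀−γt)|n|}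 ≤ C · Σ_{n∈ℤ^d} max( ‖α_n(0,·)‖_{L^∞(μ)}, ‖β_n(0,·)‖_{L^∞(μ)} )·e^{δ₀|n|}. (This is the sharp semigroup bound ‖S_t(r₀,u₀)‖_{δ₀−γt} ≤ C‖(r₀,u₀)‖_{δ₀} for the linearized system, expressed mode by mode.) -/
open MeasureTheory Complex ENNReal

noncomputable section

/-- Scalar product `n·w` of `n ∈ ℤ^d` with `w ∈ ℝ^d`. -/
def zdot {d : ℕ} (n : Fin d → ℤ) (w : Fin d → ℝ) : ℝ := ∑ j, (n j : ℝ) * w j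

/-- The dispersion function
`Λ_n(λ) = i·P_n(∫ [ -|n|² Φ(w)/(λ+i n·w)² - i (Σ_j n_j ∂_jΦ(w))/(λ+i n·w) ] dμ(w))`. -/
def Lam {d m : ℕ} (μ : Measure (Fin d → ℝ)) (Φ : (Fin d → ℝ) → (Fin m → ℂ))
    (Pn : (Fin m → ℂ) →L[ℂ] ℂ) (n : Fin d → ℤ) (lam : ℂ) : ℂ :=
  Complex.I * Pn (∫ w,
    (-(((∑ j, ((n j : ℝ)) ^ 2 : ℝ)) : ℂ) / (lam + Complex.I * (zdot n w : ℂ)) ^ 2) • Φ w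
      + (-Complex.I / (lam + Complex.I * (zdot n w : ℂ))) •
          (∑ j, (n j : ℂ) • fderiv ℝ Φ w (Pi.single j 1)) ∂μ)

/-- The macroscopic observable
`I(α, β) = P_n(∫ [Φ(w) α(w) + Σ_j β_j(w) ∂_jΦ(w)] dμ(w))`. -/
def Iobs {d m : ℕ} (μ : Measure (Fin d → ℝ)) (Φ : (Fin d → ℝ) → (Fin m → ℂ))
    (Pn : (Fin m → ℂ) →L[ℂ] ℂ) (α : (Fin d → ℝ) → ℂ)
    (β : (Fin d → ℝ) → (Fin d → ℂ)) : ℂ :=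
  Pn (∫ w, α w • Φ w + ∑ j, β w j • fderiv ℝ Φ w (Pi.single j 1) ∂μ)

/-- Mild solution of the `n`-th Fourier mode of the linearized multiphasic
system with data `(α₀, β₀)`: a jointly measurable pair `(α, β)`, essentially
bounded on `[0,T] × ℝ^d` for every `T > 0`, satisfying the Duhamel formulas. -/
def IsMildSolution {d m : ℕ} (μ : Measure (Fin d → ℝ))
    (Φ : (Fin d → ℝ) → (Fin m → ℂ)) (Pn : (Fin m → ℂ) →L[ℂ] ℂ)
    (n : Fin d → ℤ) (α : ℝ → (Fin d → ℝ) → ℂ)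
    (β : ℝ → (Fin d → ℝ) → (Fin d → ℂ))
    (α₀ : (Fin d → ℝ) → ℂ) (β₀ : (Fin d → ℝ) → (Fin d → ℂ)) : Prop :=
  Measurable (Function.uncurry α) ∧ Measurable (Function.uncurry β) ∧
  (∀ T > (0 : ℝ), ∃ B : ℝ, ∀ t ∈ Set.Icc (0 : ℝ) T,
    ∀ᵐ w ∂μ, ‖α t w‖ ≤ B ∧ ‖β t w‖ ≤ B) ∧
  (∀ t : ℝ, 0 ≤ t → ∀ᵐ w ∂μ,
    (α t w = Complex.exp (-Complex.I * (t : ℂ) * (zdot n w : ℂ))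
        * (α₀ w - Complex.I * (t : ℂ) * ∑ j, (n j : ℂ) * β₀ w j)
      - ((znorm n : ℂ)) ^ 2
        * ∫ s in (0 : ℝ)..t, ((t - s : ℝ) : ℂ)
            * Complex.exp (-Complex.I * ((t - s : ℝ) : ℂ) * (zdot n w : ℂ))
            * Iobs μ Φ Pn (α s) (β s))
    ∧ ∀ j, β t w j = Complex.exp (-Complex.I * (t : ℂ) * (zdot n w : ℂ)) * β₀ w j
      - Complex.I * (n j : ℂ)
        * ∫ s in (0 : ℝ)..t,
            Complex.exp (-Complex.I * ((t - s : ℝ) : ℂ) * (zdot n w : ℂ))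
            * Iobs μ Φ Pn (α s) (β s))

section

open Filter Topology Set

section

variable {X : Type*} [MeasurableSpace X] {E : Type*} [NormedAddCommGroup E] [NormedSpace ℂ E]

/-- The resolvent transform `∫ k₀/(λ+ia) + k₁/(λ+ia)² dμ`. -/
def imagResolvent (μ : Measure X) (a : X → ℝ) (k₀ k₁ : X → E) (lam : ℂ) : E :=
  ∫ x, (lam + I * a x)⁻¹ • k₀ x + ((lam + I * a x)⁻¹ ^ 2) • k₁ x ∂μ

/-- The oscillatory transform `∫ e^{-ita} (k₀ + t k₁) dμ`. -/
def waveTransform (μ : Measure X) (a : X → ℝ) (k₀ k₁ : X → ℂ) (t : ℝ) : ℂ :=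
  ∫ x, Complex.exp (-I * t * a x) * (k₀ x + t * k₁ x) ∂μ

theorem re_le_norm_add_I_mul (lam : ℂ) (a : ℝ) : lam.re ≤ ‖lam + I * a‖ := by
  simpa using Complex.re_le_norm (lam + I * a)

theorem add_I_mul_ne_zero {lam : ℂ} (h : 0 < lam.re) (a : ℝ) : lam + I * a ≠ 0 := by
  have := re_le_norm_add_I_mul lam a
  exact norm_pos_iff.1 (h.trans_le this)

theorem norm_inv_add_I_mul_le {σ : ℝ} (hσ : 0 < σ) {lam : ℂ} (h : σ ≤ lam.re) (a : ℝ) :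
    ‖(lam + I * a)⁻¹‖ ≤ σ⁻¹ := by
  rw [norm_inv]
  exact inv_anti₀ hσ (h.trans (re_le_norm_add_I_mul lam a))

theorem norm_resolvent_integrand_le {σ : ℝ} (hσ : 0 < σ) {lam : ℂ} (h : σ ≤ lam.re) (a : ℝ)
    (k₀ k₁ : E) :
    ‖(lam + I * a)⁻¹ • k₀ + ((lam + I * a)⁻¹ ^ 2) • k₁‖
      ≤ ‖(lam + I * a)⁻¹‖ * (‖k₀‖ + ‖k₁‖ / σ) := by
  refine (norm_add_le _ _).trans ?_
  rw [norm_smul, norm_smul, norm_pow, pow_two, mul_add, mul_assoc]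
  gcongr
  rw [div_eq_inv_mul]
  gcongr
  exact norm_inv_add_I_mul_le hσ h a

theorem norm_resolvent_integrand_le' {σ : ℝ} (hσ : 0 < σ) {lam : ℂ} (h : σ ≤ lam.re) (a : ℝ)
    (k₀ k₁ : E) :
    ‖(lam + I * a)⁻¹ • k₀ + ((lam + I * a)⁻¹ ^ 2) • k₁‖
      ≤ σ⁻¹ * (‖k₀‖ + ‖k₁‖ / σ) := by
  refine (norm_resolvent_integrand_le hσ h a k₀ k₁).trans ?_
  gcongr
  exact norm_inv_add_I_mul_le hσ h a

section
variable {μ : Measure X} {a : X → ℝ} {k₀ k₁ : X → E}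

theorem aestronglyMeasurable_resolvent_integrand (ha : Measurable a)
    (h₀ : AEStronglyMeasurable k₀ μ) (h₁ : AEStronglyMeasurable k₁ μ) (lam : ℂ) :
    AEStronglyMeasurable
      (fun x => (lam + I * a x)⁻¹ • k₀ x + ((lam + I * a x)⁻¹ ^ 2) • k₁ x) μ := by
  have h : Measurable fun x => (lam + I * a x)⁻¹ := by fun_prop
  exact (h.aestronglyMeasurable.smul h₀).add ((h.pow_const 2).aestronglyMeasurable.smul h₁)

theorem integrable_resolvent_integrand (ha : Measurable a) (h₀ : Integrable k₀ μ)
    (h₁ : Integrable k₁ μ) {lam : ℂ} (hlam : 0 < lam.re) :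
    Integrable (fun x => (lam + I * a x)⁻¹ • k₀ x + ((lam + I * a x)⁻¹ ^ 2) • k₁ x) μ :=
  Integrable.mono' ((h₀.norm.add (h₁.norm.div_const lam.re)).const_mul lam.re⁻¹)
    (aestronglyMeasurable_resolvent_integrand ha h₀.1 h₁.1 lam)
    (Eventually.of_forall fun _ => norm_resolvent_integrand_le' hlam le_rfl _ _ _)

theorem norm_imagResolvent_le (h₀ : Integrable k₀ μ)
    (h₁ : Integrable k₁ μ) {σ : ℝ} (hσ : 0 < σ) {lam : ℂ} (hlam : σ ≤ lam.re) :
    ‖imagResolvent μ a k₀ k₁ lam‖ ≤ σ⁻¹ * ∫ x, (‖k₀ x‖ + ‖k₁ x‖ / σ) ∂μ := by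
  rw [← integral_const_mul]
  exact norm_integral_le_of_norm_le
    ((h₀.norm.add (h₁.norm.div_const σ)).const_mul σ⁻¹)
    (Eventually.of_forall fun _ => norm_resolvent_integrand_le' hσ hlam _ _ _)

theorem differentiableAt_imagResolvent (ha : Measurable a) (h₀ : Integrable k₀ μ)
    (h₁ : Integrable k₁ μ) {lam : ℂ} (hlam : 0 < lam.re) :
    DifferentiableAt ℂ (imagResolvent μ a k₀ k₁) lam := by
  set s : ℝ := lam.re / 2 with hs
  have hs0 : 0 < s := by positivity
  have hU : {z : ℂ | s < z.re} ∈ 𝓝 lam :=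
    (isOpen_lt continuous_const Complex.continuous_re).mem_nhds (by simp [hs]; linarith)
  refine (hasDerivAt_integral_of_dominated_loc_of_deriv_le (𝕜 := ℂ) (E := E)
    (F := fun z x => (z + I * a x)⁻¹ • k₀ x + ((z + I * a x)⁻¹ ^ 2) • k₁ x)
    (F' := fun z x => (-((z + I * a x)⁻¹ ^ 2)) • k₀ x + (-2 * (z + I * a x)⁻¹ ^ 3) • k₁ x)
    (bound := fun x => s⁻¹ ^ 2 * ‖k₀ x‖ + 2 * s⁻¹ ^ 3 * ‖k₁ x‖)
    hU ?_ (integrable_resolvent_integrand ha h₀ h₁ hlam) ?_ ?_ ?_ ?_).2.differentiableAt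
  · exact Eventually.of_forall fun z => aestronglyMeasurable_resolvent_integrand ha h₀.1 h₁.1 z
  · have h : Measurable fun x => (lam + I * a x)⁻¹ := by fun_prop
    exact ((h.pow_const 2).neg.aestronglyMeasurable.smul h₀.1).add
      (((h.pow_const 3).const_mul (-2)).aestronglyMeasurable.smul h₁.1)
  · refine Eventually.of_forall fun x z hz => (norm_add_le _ _).trans ?_
    have := norm_inv_add_I_mul_le hs0 (le_of_lt hz) (a x)
    rw [norm_smul, norm_smul, norm_neg, norm_mul, norm_pow, norm_pow]
    simp only [norm_neg, Complex.norm_ofNat]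
    gcongr
  · exact (h₀.norm.const_mul _).add (h₁.norm.const_mul _)
  · refine Eventually.of_forall fun x z hz => ?_
    have hne : z + I * a x ≠ 0 := add_I_mul_ne_zero (hs0.trans hz) _
    have h1 : HasDerivAt (fun z : ℂ => (z + I * a x)⁻¹) (-((z + I * a x)⁻¹ ^ 2)) z := by
      have := ((hasDerivAt_id z).add_const (I * (a x : ℂ))).fun_inv hne
      refine this.congr_deriv ?_
      simp [neg_div]
    have h2 : HasDerivAt (fun z : ℂ => (z + I * a x)⁻¹ ^ 2) (-2 * (z + I * a x)⁻¹ ^ 3) z := by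
      refine (h1.fun_pow 2).congr_deriv ?_
      push_cast; ring
    exact (h1.smul_const _).add (h2.smul_const _)

/-- The resolvent transform vanishes at infinity along vertical lines. -/
theorem tendsto_imagResolvent_vertical (ha : Measurable a) (h₀ : Integrable k₀ μ)
    (h₁ : Integrable k₁ μ) {s : ℝ} (hs : 0 < s) {l : Filter ℝ} [l.IsCountablyGenerated]
    (hl : Tendsto (fun T : ℝ => |T|) l atTop) :
    Tendsto (fun T : ℝ => imagResolvent μ a k₀ k₁ (s + T * I)) l (𝓝 0) := by
  have hre : ∀ T : ℝ, ((s : ℂ) + T * I).re = s := by simp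
  rw [show (0 : E) = ∫ _ : X, (0 : E) ∂μ by simp]
  refine tendsto_integral_filter_of_dominated_convergence
    (fun x => s⁻¹ * (‖k₀ x‖ + ‖k₁ x‖ / s))
    (Eventually.of_forall fun z => aestronglyMeasurable_resolvent_integrand ha h₀.1 h₁.1 _)
    (Eventually.of_forall fun T => Eventually.of_forall fun x =>
      norm_resolvent_integrand_le' hs (hre T).ge _ _ _)
    ((h₀.norm.add (h₁.norm.div_const s)).const_mul s⁻¹)
    (Eventually.of_forall fun x => ?_)
  have hinv : Tendsto (fun T : ℝ => ((s : ℂ) + T * I + I * a x)⁻¹) l (𝓝 0) := by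
    refine tendsto_inv₀_cobounded.comp (tendsto_norm_atTop_iff_cobounded.1 ?_)
    refine tendsto_atTop_mono (f := fun T : ℝ => |T| - |a x|) (fun T => ?_)
      (tendsto_atTop_add_const_right _ _ hl)
    have := Complex.abs_im_le_norm ((s : ℂ) + T * I + I * a x)
    simp only [add_im, ofReal_im, mul_im, ofReal_re, I_im, mul_one, I_re, mul_zero,
      zero_add, one_mul, add_zero] at this
    have h2 := abs_sub_abs_le_abs_sub T (-a x)
    rw [abs_neg, sub_neg_eq_add] at h2
    exact h2.trans this
  simpa using (hinv.smul_const (k₀ x)).add ((hinv.pow 2).smul_const (k₁ x))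

end

end

section

variable {X : Type*} [MeasurableSpace X]

theorem integrableOn_mul_exp_neg {σ : ℝ} (hσ : 0 < σ) :
    IntegrableOn (fun t : ℝ => t * Real.exp (-σ * t)) (Ioi 0) := by
  simpa using integrableOn_rpow_mul_exp_neg_mul_rpow (p := 1) (s := 1) (by norm_num) one_pos hσ

theorem integrableOn_exp_neg {σ : ℝ} (hσ : 0 < σ) :
    IntegrableOn (fun t : ℝ => Real.exp (-σ * t)) (Ioi 0) := by
  simpa using integrableOn_rpow_mul_exp_neg_mul_rpow (p := 1) (s := 0) (by norm_num) one_pos hσ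

theorem norm_cexp_neg_mul_ofReal (z : ℂ) (t : ℝ) :
    ‖Complex.exp (-z * t)‖ = Real.exp (-z.re * t) := by
  rw [Complex.norm_exp]; simp

theorem integrableOn_cexp_neg {z : ℂ} (hz : 0 < z.re) :
    IntegrableOn (fun t : ℝ => Complex.exp (-z * t)) (Ioi 0) :=
  Integrable.mono' (integrableOn_exp_neg hz) (Continuous.aestronglyMeasurable (by fun_prop))
    (Eventually.of_forall fun t => (norm_cexp_neg_mul_ofReal z t).le)

theorem integrableOn_mul_cexp_neg {z : ℂ} (hz : 0 < z.re) :
    IntegrableOn (fun t : ℝ => (t : ℂ) * Complex.exp (-z * t)) (Ioi 0) := by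
  refine Integrable.mono' (integrableOn_mul_exp_neg hz)
    (Continuous.aestronglyMeasurable (by fun_prop)) ?_
  filter_upwards [ae_restrict_mem measurableSet_Ioi] with t ht
  rw [norm_mul, norm_cexp_neg_mul_ofReal, Complex.norm_of_nonneg (le_of_lt ht)]

theorem integral_cexp_neg {z : ℂ} (hz : 0 < z.re) :
    ∫ t in Ioi (0 : ℝ), Complex.exp (-z * t) = z⁻¹ := by
  have h := integral_exp_mul_complex_Ioi (a := -z) (by simpa using hz) 0
  rw [h]; simp [neg_div_neg_eq]

theorem integral_mul_cexp_neg {z : ℂ} (hz : 0 < z.re) :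
    ∫ t in Ioi (0 : ℝ), (t : ℂ) * Complex.exp (-z * t) = z⁻¹ ^ 2 := by
  have hz0 : z ≠ 0 := by rintro rfl; simp at hz
  have hd : ∀ t : ℝ, HasDerivAt
      (fun t : ℝ => -((t : ℂ) * z⁻¹ + z⁻¹ ^ 2) * Complex.exp (-z * t))
      ((t : ℂ) * Complex.exp (-z * t)) t := by
    intro t
    have h1 : HasDerivAt (fun t : ℝ => (t : ℂ)) 1 t := Complex.ofRealCLM.hasDerivAt
    have h2 := (h1.const_mul (-z)).cexp
    refine (((h1.mul_const z⁻¹).add_const (z⁻¹ ^ 2)).fun_neg.fun_mul h2).congr_deriv ?_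
    field_simp; ring
  have hlim : Tendsto (fun t : ℝ => -((t : ℂ) * z⁻¹ + z⁻¹ ^ 2) * Complex.exp (-z * t))
      atTop (𝓝 0) := by
    have e1 : Tendsto (fun t : ℝ => (t : ℂ) * Complex.exp (-z * t)) atTop (𝓝 0) := by
      rw [tendsto_zero_iff_norm_tendsto_zero]
      have := (tendsto_rpow_mul_exp_neg_mul_atTop_nhds_zero 1 z.re hz)
      refine this.congr' ?_
      filter_upwards [eventually_ge_atTop 0] with t ht
      rw [norm_mul, norm_cexp_neg_mul_ofReal, Complex.norm_of_nonneg ht, Real.rpow_one]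
    have e2 : Tendsto (fun t : ℝ => Complex.exp (-z * t)) atTop (𝓝 0) := by
      rw [tendsto_zero_iff_norm_tendsto_zero]
      have := (tendsto_rpow_mul_exp_neg_mul_atTop_nhds_zero 0 z.re hz)
      refine this.congr fun t => ?_
      rw [norm_cexp_neg_mul_ofReal, Real.rpow_zero, one_mul]
    have := (e1.const_mul (-z⁻¹)).add (e2.const_mul (-z⁻¹ ^ 2))
    simp only [mul_zero, add_zero] at this
    refine this.congr fun t => by ring
  rw [integral_Ioi_of_hasDerivAt_of_tendsto' (fun t _ => hd t) (integrableOn_mul_cexp_neg hz) hlim]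
  simp

section
variable {μ : Measure X} {a : X → ℝ} {k₀ k₁ : X → ℂ}

theorem norm_cexp_neg_I_mul (t b : ℝ) : ‖Complex.exp (-I * t * b)‖ = 1 := by
  rw [Complex.norm_exp]; simp

theorem aestronglyMeasurable_wave_integrand (ha : Measurable a) (h₀ : AEStronglyMeasurable k₀ μ)
    (h₁ : AEStronglyMeasurable k₁ μ) (t : ℝ) :
    AEStronglyMeasurable (fun x => Complex.exp (-I * t * a x) * (k₀ x + t * k₁ x)) μ := by
  have h : Measurable fun x => Complex.exp (-I * t * a x) := by fun_prop
  exact h.aestronglyMeasurable.mul (h₀.add (h₁.const_mul _))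

theorem norm_wave_integrand_le (a t : ℝ) (k₀ k₁ : ℂ) :
    ‖Complex.exp (-I * t * a) * (k₀ + t * k₁)‖ ≤ ‖k₀‖ + |t| * ‖k₁‖ := by
  rw [norm_mul, norm_cexp_neg_I_mul, one_mul]
  refine (norm_add_le _ _).trans ?_
  simp

theorem norm_waveTransform_le (h₀ : Integrable k₀ μ) (h₁ : Integrable k₁ μ) (t : ℝ) :
    ‖waveTransform μ a k₀ k₁ t‖ ≤ ∫ x, ‖k₀ x‖ ∂μ + |t| * ∫ x, ‖k₁ x‖ ∂μ := by
  rw [← integral_const_mul, ← integral_add h₀.norm (h₁.norm.const_mul _)]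
  exact norm_integral_le_of_norm_le (h₀.norm.add (h₁.norm.const_mul _))
    (Eventually.of_forall fun _ => norm_wave_integrand_le _ _ _ _)

theorem continuous_waveTransform (ha : Measurable a) (h₀ : Integrable k₀ μ)
    (h₁ : Integrable k₁ μ) : Continuous (waveTransform μ a k₀ k₁) := by
  rw [continuous_iff_continuousAt]
  intro t
  refine continuousAt_of_dominated (bound := fun x => ‖k₀ x‖ + (|t| + 1) * ‖k₁ x‖)
    (Eventually.of_forall fun s => aestronglyMeasurable_wave_integrand ha h₀.1 h₁.1 s) ?_
    (h₀.norm.add (h₁.norm.const_mul _)) (Eventually.of_forall fun x => ?_)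
  · have : ∀ᶠ s in 𝓝 t, |s| < |t| + 1 :=
      continuous_abs.continuousAt.eventually_lt_const (by linarith)
    filter_upwards [this] with s hs
    refine Eventually.of_forall fun x => (norm_wave_integrand_le _ _ _ _).trans ?_
    gcongr
  · fun_prop

theorem integrable_laplace_wave_integrand [SFinite μ] (ha : Measurable a) (h₀ : Integrable k₀ μ)
    (h₁ : Integrable k₁ μ) {lam : ℂ} (hlam : 0 < lam.re) :
    Integrable (fun p : ℝ × X => Complex.exp (-lam * p.1) *
      (Complex.exp (-I * p.1 * a p.2) * (k₀ p.2 + p.1 * k₁ p.2)))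
      ((volume.restrict (Ioi 0)).prod μ) := by
  have e : (fun p : ℝ × X => Complex.exp (-lam * p.1) *
      (Complex.exp (-I * p.1 * a p.2) * (k₀ p.2 + p.1 * k₁ p.2))) =
      fun p : ℝ × X => Complex.exp (-I * p.1 * a p.2) * (Complex.exp (-lam * p.1) * k₀ p.2 +
        (p.1 * Complex.exp (-lam * p.1)) * k₁ p.2) := by
    ext p; ring
  rw [e]
  have hm : Measurable fun p : ℝ × X => Complex.exp (-I * p.1 * a p.2) := by fun_prop
  refine Integrable.bdd_mul (c := 1) (((integrableOn_cexp_neg hlam).mul_prod h₀).add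
    ((integrableOn_mul_cexp_neg hlam).mul_prod h₁)) hm.aestronglyMeasurable
    (Eventually.of_forall fun p => (norm_cexp_neg_I_mul _ _).le)

/-- The Laplace transform of a wave transform is a resolvent transform. -/
theorem laplace_waveTransform [SFinite μ] (ha : Measurable a) (h₀ : Integrable k₀ μ)
    (h₁ : Integrable k₁ μ) {lam : ℂ} (hlam : 0 < lam.re) :
    IntegrableOn (fun t : ℝ => Complex.exp (-lam * t) * waveTransform μ a k₀ k₁ t) (Ioi 0) ∧
    ∫ t in Ioi (0 : ℝ), Complex.exp (-lam * t) * waveTransform μ a k₀ k₁ t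
      = imagResolvent μ a k₀ k₁ lam := by
  have hi := integrable_laplace_wave_integrand ha h₀ h₁ hlam
  constructor
  · refine hi.integral_prod_left.congr (Eventually.of_forall fun t => ?_)
    simp only [waveTransform]
    rw [integral_const_mul]
  · simp only [waveTransform, ← integral_const_mul]
    rw [integral_integral_swap hi]
    refine integral_congr_ae (Eventually.of_forall fun x => ?_)
    have hz : 0 < (lam + I * a x).re := by simpa using hlam
    simp only
    have e : ∀ t : ℝ, Complex.exp (-lam * t) * (Complex.exp (-I * t * a x) * (k₀ x + t * k₁ x))
        = Complex.exp (-(lam + I * a x) * t) * k₀ x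
          + (t * Complex.exp (-(lam + I * a x) * t)) * k₁ x := by
      intro t
      rw [← mul_assoc, ← Complex.exp_add,
        show -lam * t + -I * t * a x = -(lam + I * a x) * t by ring]
      ring
    simp only [e]
    rw [integral_add ((integrableOn_cexp_neg hz).mul_const _)
      ((integrableOn_mul_cexp_neg hz).mul_const _), integral_mul_const, integral_mul_const,
      integral_cexp_neg hz, integral_mul_cexp_neg hz]
    rfl

end

end

section

variable {X : Type*} [MeasurableSpace X]

theorem norm_inv_vertical_sq {σ : ℝ} (hσ : 0 < σ) (w b : ℝ) :
    ‖((σ : ℂ) + w * I + I * b)⁻¹‖ ^ 2 = σ⁻¹ ^ 2 * (1 + ((w + b) / σ) ^ 2)⁻¹ := by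
  have : (σ : ℂ) + w * I + I * b = (σ : ℂ) + ((w + b : ℝ) : ℂ) * I := by push_cast; ring
  rw [this, norm_inv, inv_pow, Complex.sq_norm, Complex.normSq_add_mul_I]
  field_simp

theorem lintegral_norm_inv_vertical_sq {σ : ℝ} (hσ : 0 < σ) (b : ℝ) :
    ∫⁻ w : ℝ, ENNReal.ofReal (‖((σ : ℂ) + w * I + I * b)⁻¹‖ ^ 2)
      = ENNReal.ofReal (Real.pi / σ) := by
  simp only [norm_inv_vertical_sq hσ]
  have hi : Integrable fun w : ℝ => σ⁻¹ ^ 2 * (1 + ((w + b) / σ) ^ 2)⁻¹ := by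
    have h1 : Integrable fun w : ℝ => (1 + (w / σ) ^ 2)⁻¹ :=
      integrable_inv_one_add_sq.comp_div hσ.ne'
    exact (h1.comp_add_right b).const_mul _
  rw [← ofReal_integral_eq_lintegral_ofReal hi (Eventually.of_forall fun w => by positivity),
    integral_const_mul, integral_add_right_eq_self (fun w : ℝ => (1 + (w / σ) ^ 2)⁻¹) b,
    Measure.integral_comp_div (fun w : ℝ => (1 + w ^ 2)⁻¹) σ, integral_univ_inv_one_add_sq,
    abs_of_pos hσ, smul_eq_mul]
  congr 1
  field_simp

theorem lintegral_inv_vertical_mul_le {σ : ℝ} (hσ : 0 < σ) (b b' : ℝ) :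
    ∫⁻ w : ℝ, ‖((σ : ℂ) + w * I + I * b)⁻¹‖ₑ * ‖((σ : ℂ) + w * I + I * b')⁻¹‖ₑ
      ≤ ENNReal.ofReal (Real.pi / σ) := by
  have hm : ∀ c : ℝ, Measurable fun w : ℝ =>
      ENNReal.ofReal (‖((σ : ℂ) + w * I + I * c)⁻¹‖ ^ 2) := fun c => by fun_prop
  calc _ ≤ ∫⁻ w : ℝ, 2⁻¹ * (ENNReal.ofReal (‖((σ : ℂ) + w * I + I * b)⁻¹‖ ^ 2)
        + ENNReal.ofReal (‖((σ : ℂ) + w * I + I * b')⁻¹‖ ^ 2)) := by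
        refine lintegral_mono fun w => ?_
        rw [← ofReal_norm, ← ofReal_norm, ← ENNReal.ofReal_mul (norm_nonneg _),
          ← ENNReal.ofReal_add (by positivity) (by positivity),
          show (2⁻¹ : ℝ≥0∞) = ENNReal.ofReal 2⁻¹ by
            rw [ENNReal.ofReal_inv_of_pos (by norm_num)]; simp,
          ← ENNReal.ofReal_mul (by norm_num)]
        apply ENNReal.ofReal_le_ofReal
        nlinarith [sq_nonneg (‖((σ : ℂ) + w * I + I * b)⁻¹‖ - ‖((σ : ℂ) + w * I + I * b')⁻¹‖)]
    _ = ENNReal.ofReal (Real.pi / σ) := by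
        rw [lintegral_const_mul _ (by fun_prop), lintegral_add_left (hm b),
          lintegral_norm_inv_vertical_sq hσ, lintegral_norm_inv_vertical_sq hσ, ← two_mul,
          ← mul_assoc, ENNReal.inv_mul_cancel (by simp) (by simp), one_mul]

section
variable {μ : Measure X} {a : X → ℝ} {k₀ k₁ f₀ f₁ : X → ℂ}

theorem enorm_imagResolvent_le {σ : ℝ} (hσ : 0 < σ) (w : ℝ) :
    ‖imagResolvent μ a k₀ k₁ (σ + w * I)‖ₑ ≤
      ∫⁻ x, ‖((σ : ℂ) + w * I + I * a x)⁻¹‖ₑ * ENNReal.ofReal (‖k₀ x‖ + ‖k₁ x‖ / σ) ∂μ := by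
  refine (enorm_integral_le_lintegral_enorm _).trans (lintegral_mono fun x => ?_)
  rw [← ofReal_norm, ← ofReal_norm, ← ENNReal.ofReal_mul (norm_nonneg _)]
  exact ENNReal.ofReal_le_ofReal (norm_resolvent_integrand_le hσ (by simp) _ _ _)

/-- The product of two resolvent transforms is integrable along vertical lines. -/
theorem lintegral_imagResolvent_mul_le [SFinite μ] (ha : Measurable a)
    (hk₀ : Integrable k₀ μ) (hk₁ : Integrable k₁ μ) (hf₀ : Integrable f₀ μ) (hf₁ : Integrable f₁ μ)
    {σ : ℝ} (hσ : 0 < σ) :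
    ∫⁻ w : ℝ, ‖imagResolvent μ a k₀ k₁ (σ + w * I)‖ₑ *
        ‖imagResolvent μ a f₀ f₁ (σ + w * I)‖ₑ
      ≤ ENNReal.ofReal (Real.pi / σ * ((∫ x, (‖k₀ x‖ + ‖k₁ x‖ / σ) ∂μ) *
          ∫ x, (‖f₀ x‖ + ‖f₁ x‖ / σ) ∂μ)) := by
  have hik : Integrable (fun x => ‖k₀ x‖ + ‖k₁ x‖ / σ) μ := hk₀.norm.add (hk₁.norm.div_const σ)
  have hif : Integrable (fun x => ‖f₀ x‖ + ‖f₁ x‖ / σ) μ := hf₀.norm.add (hf₁.norm.div_const σ)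
  set kk : X → ℝ≥0∞ := fun x => ENNReal.ofReal (‖k₀ x‖ + ‖k₁ x‖ / σ) with hkk
  set ff : X → ℝ≥0∞ := fun x => ENNReal.ofReal (‖f₀ x‖ + ‖f₁ x‖ / σ) with hff
  have hkm : AEMeasurable kk μ := hik.aestronglyMeasurable.aemeasurable.ennreal_ofReal
  have hfm : AEMeasurable ff μ := hif.aestronglyMeasurable.aemeasurable.ennreal_ofReal
  set r : ℝ → X → ℝ≥0∞ := fun w x => ‖((σ : ℂ) + w * I + I * a x)⁻¹‖ₑ with hr
  have hrm : Measurable (Function.uncurry r) := by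
    simp only [hr, Function.uncurry_def]; fun_prop
  have hrm' : ∀ w, Measurable (r w) := fun w => by simp only [hr]; fun_prop
  calc _ ≤ ∫⁻ w : ℝ, (∫⁻ x, r w x * kk x ∂μ) * ∫⁻ x, r w x * ff x ∂μ :=
        lintegral_mono fun w => mul_le_mul' (enorm_imagResolvent_le hσ w)
          (enorm_imagResolvent_le hσ w)
    _ = ∫⁻ w : ℝ, ∫⁻ p : X × X, (r w p.1 * r w p.2) * (kk p.1 * ff p.2) ∂(μ.prod μ) := by
        refine lintegral_congr fun w => ?_
        rw [← lintegral_prod_mul (f := fun x => r w x * kk x) (g := fun x => r w x * ff x)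
          ((hrm' w).aemeasurable.mul hkm) ((hrm' w).aemeasurable.mul hfm)]
        exact lintegral_congr fun p => by ring
    _ = ∫⁻ p : X × X, (∫⁻ w : ℝ, (r w p.1 * r w p.2) * (kk p.1 * ff p.2)) ∂(μ.prod μ) := by
        refine lintegral_lintegral_swap ?_
        have h1 : Measurable fun q : ℝ × X × X => r q.1 q.2.1 * r q.1 q.2.2 :=
          (hrm.comp (f := fun q : ℝ × X × X => (q.1, q.2.1)) (by fun_prop)).mul
            (hrm.comp (f := fun q : ℝ × X × X => (q.1, q.2.2)) (by fun_prop))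
        have h2 : AEMeasurable (fun p : X × X => kk p.1 * ff p.2) (μ.prod μ) :=
          hkm.comp_fst.mul hfm.comp_snd
        exact h1.aemeasurable.mul h2.comp_snd
    _ ≤ ∫⁻ p : X × X, ENNReal.ofReal (Real.pi / σ) * (kk p.1 * ff p.2) ∂(μ.prod μ) := by
        refine lintegral_mono fun p => ?_
        have hm : Measurable fun w : ℝ => r w p.1 * r w p.2 := by simp only [hr]; fun_prop
        simp only
        rw [lintegral_mul_const _ hm]
        gcongr
        exact lintegral_inv_vertical_mul_le hσ _ _
    _ = _ := by
        have hw : AEMeasurable (fun p : X × X => kk p.1 * ff p.2) (μ.prod μ) :=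
          hkm.comp_fst.mul hfm.comp_snd
        rw [lintegral_const_mul'' _ hw, lintegral_prod_mul hkm hfm,
          ENNReal.ofReal_mul (by positivity),
          ENNReal.ofReal_mul (integral_nonneg fun x => by positivity),
          ofReal_integral_eq_lintegral_ofReal hik (Eventually.of_forall fun x => by positivity),
          ofReal_integral_eq_lintegral_ofReal hif (Eventually.of_forall fun x => by positivity)]

end

end

/-- Shifting a vertical contour. -/
theorem integral_vertical_eq {f : ℂ → ℂ} {σ₁ σ₂ : ℝ} (h : σ₁ ≤ σ₂)
    (hd : ∀ z : ℂ, σ₁ ≤ z.re → DifferentiableAt ℂ f z)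
    (hi₁ : Integrable fun w : ℝ => f (σ₁ + w * I)) (hi₂ : Integrable fun w : ℝ => f (σ₂ + w * I))
    {B : ℝ} (hB : ∀ z : ℂ, σ₁ ≤ z.re → z.re ≤ σ₂ → ‖f z‖ ≤ B)
    (htop : ∀ s : ℝ, σ₁ ≤ s → Tendsto (fun T : ℝ => f (s + T * I)) atTop (𝓝 0))
    (hbot : ∀ s : ℝ, σ₁ ≤ s → Tendsto (fun T : ℝ => f (s + T * I)) atBot (𝓝 0)) :
    ∫ w : ℝ, f (σ₁ + w * I) = ∫ w : ℝ, f (σ₂ + w * I) := by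
  have hrect : ∀ T : ℝ, (∫ x : ℝ in σ₁..σ₂, f (x + (-T : ℝ) * I))
      - (∫ x : ℝ in σ₁..σ₂, f (x + T * I)) + I • (∫ y : ℝ in (-T)..T, f (σ₂ + y * I))
      - I • (∫ y : ℝ in (-T)..T, f (σ₁ + y * I)) = 0 := by
    intro T
    have := integral_boundary_rect_eq_zero_of_differentiableOn f
      ((σ₁ : ℂ) + (-T : ℝ) * I) ((σ₂ : ℂ) + T * I) ?_
    · simpa using this
    · intro z hz
      refine (hd z ?_).differentiableWithinAt
      have := hz.1
      simp only [mem_preimage, add_re, ofReal_re, mul_re, I_re, mul_zero, ofReal_im, I_im,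
        mul_one, sub_self, add_zero, uIcc_of_le h] at this
      exact this.1
  have hhor : ∀ l : Filter ℝ, l.IsCountablyGenerated →
      (∀ s : ℝ, σ₁ ≤ s → Tendsto (fun T : ℝ => f (s + T * I)) l (𝓝 0)) →
      Tendsto (fun T : ℝ => ∫ x : ℝ in σ₁..σ₂, f (x + T * I)) l (𝓝 0) := by
    intro l hl hlim
    rw [show (0 : ℂ) = ∫ x : ℝ in σ₁..σ₂, (0 : ℂ) by simp]
    refine intervalIntegral.tendsto_integral_filter_of_dominated_convergence (fun _ => B)
      (Eventually.of_forall fun T => ?_) (Eventually.of_forall fun T => ?_) (by simp)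
      (Eventually.of_forall fun x hx => ?_)
    · refine ContinuousOn.aestronglyMeasurable (fun x hx => ?_) measurableSet_uIoc
      rw [uIoc_of_le h] at hx
      have h1 : ContinuousAt f ((x : ℂ) + T * I) := (hd _ (by simpa using hx.1.le)).continuousAt
      have h2 : ContinuousAt (fun x : ℝ => (x : ℂ) + T * I) x := by fun_prop
      exact (ContinuousAt.comp (f := fun x : ℝ => (x : ℂ) + T * I) h1 h2).continuousWithinAt
    · refine Eventually.of_forall fun x hx => ?_
      rw [uIoc_of_le h] at hx
      exact hB _ (by simpa using hx.1.le) (by simpa using hx.2)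
    · rw [uIoc_of_le h] at hx
      exact hlim x hx.1.le
  have l1 : Tendsto (fun T : ℝ => ∫ x : ℝ in σ₁..σ₂, f (x + (-T : ℝ) * I)) atTop (𝓝 0) :=
    (hhor atBot inferInstance hbot).comp tendsto_neg_atTop_atBot
  have l2 := hhor atTop inferInstance htop
  have l3 := intervalIntegral_tendsto_integral hi₂ tendsto_neg_atTop_atBot tendsto_id
  have l4 := intervalIntegral_tendsto_integral hi₁ tendsto_neg_atTop_atBot tendsto_id
  have l5 := ((l1.sub l2).add (l3.const_smul I)).sub (l4.const_smul I)
  have l6 := tendsto_nhds_unique l5 (tendsto_const_nhds.congr fun T => (hrect T).symm)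
  have l7 : I * ((∫ w : ℝ, f (σ₂ + w * I)) - ∫ w : ℝ, f (σ₁ + w * I)) = 0 := by
    simp only [smul_eq_mul] at l6
    linear_combination l6
  exact (sub_eq_zero.1 ((mul_eq_zero.1 l7).resolve_left I_ne_zero)).symm

/-- Laplace inversion at a point of continuity. -/
theorem laplace_inversion {G : ℝ → ℂ} {H : ℂ → ℂ} {σ t : ℝ} (ht : 0 < t) (hc : ContinuousAt G t)
    (hG : IntegrableOn (fun s : ℝ => Complex.exp (-σ * s) * G s) (Ioi 0))
    (hH : ∀ w : ℝ, ∫ s in Ioi (0 : ℝ), Complex.exp (-(σ + w * I) * s) * G s = H (σ + w * I))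
    (hHi : Integrable fun w : ℝ => H (σ + w * I)) :
    G t = (2 * Real.pi : ℂ)⁻¹ * ∫ w : ℝ, Complex.exp ((σ + w * I) * t) * H (σ + w * I) := by
  set g : ℝ → ℂ := (Ioi (0 : ℝ)).indicator fun s : ℝ => Complex.exp (-σ * s) * G s with hg
  have hgi : Integrable g := (integrable_indicator_iff measurableSet_Ioi).2 hG
  have hF : ∀ ξ : ℝ, FourierTransform.fourier g ξ = H (σ + (2 * Real.pi * ξ : ℝ) * I) := by
    intro ξ
    rw [← hH, Real.fourier_eq', ← integral_indicator measurableSet_Ioi]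
    refine integral_congr_ae (Eventually.of_forall fun s => ?_)
    simp only [hg, indicator]
    split_ifs with hs
    · simp only [smul_eq_mul, RCLike.inner_apply, conj_trivial]
      rw [← mul_assoc, ← Complex.exp_add]
      congr 2
      push_cast; ring
    · simp
  have hgc : ContinuousAt g t := by
    have h1 : ContinuousAt (fun s : ℝ => Complex.exp (-σ * s) * G s) t := by fun_prop
    refine h1.congr ?_
    filter_upwards [Ioi_mem_nhds ht] with s hs
    simp only [hg]
    rw [indicator_of_mem hs]
  have hFi : Integrable (FourierTransform.fourier g) := by
    rw [show FourierTransform.fourier g = fun ξ : ℝ => H (σ + (2 * Real.pi * ξ : ℝ) * I) from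
      funext hF]
    exact hHi.comp_mul_left' (R := 2 * Real.pi) (by positivity)
  have hinv := hgi.fourierInv_fourier_eq hFi hgc
  rw [Real.fourierInv_eq'] at hinv
  simp only [hF] at hinv
  have hgt : g t = Complex.exp (-σ * t) * G t := by
    simp only [hg]
    rw [indicator_of_mem (show t ∈ Ioi (0 : ℝ) from ht)]
  have hsub := Measure.integral_comp_mul_left
    (fun w : ℝ => Complex.exp (w * t * I) * H (σ + w * I)) (2 * Real.pi)
  have e1 : (∫ ξ : ℝ, Complex.exp (((2 * Real.pi * ξ : ℝ) : ℂ) * t * I)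
      * H (σ + (2 * Real.pi * ξ : ℝ) * I)) = g t := by
    rw [← hinv]
    refine integral_congr_ae (Eventually.of_forall fun ξ => ?_)
    simp only [smul_eq_mul, RCLike.inner_apply, conj_trivial]
    congr 2
    push_cast; ring
  rw [hsub, abs_of_pos (by positivity), hgt] at e1
  have e2 : G t = Complex.exp (σ * t) * (Complex.exp (-σ * t) * G t) := by
    rw [← mul_assoc, ← Complex.exp_add]; simp
  rw [e2, ← e1, Complex.real_smul, mul_left_comm, ← integral_const_mul]
  push_cast
  congr 1
  refine integral_congr_ae (Eventually.of_forall fun w => ?_)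
  simp only
  rw [← mul_assoc, ← Complex.exp_add]
  congr 2
  ring

theorem integral_exp_mul_le {σ t : ℝ} (hσ : 0 < σ) :
    ∫ s in (0 : ℝ)..t, Real.exp (σ * s) ≤ Real.exp (σ * t) / σ := by
  have hd : ∀ s ∈ uIcc 0 t, HasDerivAt (fun s => Real.exp (σ * s) / σ) (Real.exp (σ * s)) s := by
    intro s _
    refine ((((hasDerivAt_id s).const_mul σ).exp).div_const σ).congr_deriv ?_
    simp only [id]; field_simp
  rw [intervalIntegral.integral_eq_sub_of_hasDerivAt hd
    (Continuous.intervalIntegrable (by fun_prop) _ _)]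
  have : 0 ≤ Real.exp (σ * 0) / σ := by positivity
  linarith

theorem integral_sub_mul_exp_mul_le {σ t : ℝ} (hσ : 0 < σ) (ht : 0 ≤ t) :
    ∫ s in (0 : ℝ)..t, (t - s) * Real.exp (σ * s) ≤ Real.exp (σ * t) / σ ^ 2 := by
  have hd : ∀ s ∈ uIcc 0 t, HasDerivAt (fun s => ((t - s) / σ + 1 / σ ^ 2) * Real.exp (σ * s))
      ((t - s) * Real.exp (σ * s)) s := by
    intro s _
    refine ((((hasDerivAt_id s).const_sub t).div_const σ).add_const (1 / σ ^ 2)).fun_mul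
      (((hasDerivAt_id s).const_mul σ).exp) |>.congr_deriv ?_
    simp only [id]; field_simp; ring
  rw [intervalIntegral.integral_eq_sub_of_hasDerivAt hd
    (Continuous.intervalIntegrable (by fun_prop) _ _)]
  have : 0 ≤ ((t - 0) / σ + 1 / σ ^ 2) * Real.exp (σ * 0) := by
    rw [sub_zero]; positivity
  have e : ((t - t) / σ + 1 / σ ^ 2) * Real.exp (σ * t) = Real.exp (σ * t) / σ ^ 2 := by
    rw [sub_self]; ring
  linarith

theorem norm_integral_le_exp {σ t A₀ A₁ b : ℝ} (hσ : 0 < σ) (ht : 0 ≤ t) (hA₀ : 0 ≤ A₀)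
    (hA₁ : 0 ≤ A₁) (hb : 0 ≤ b) {g : ℝ → ℂ}
    (hg : ∀ s, 0 ≤ s → s ≤ t → ‖g s‖ ≤ (A₀ + (t - s) * A₁) * (b * Real.exp (σ * s))) :
    ‖∫ s in (0 : ℝ)..t, g s‖ ≤ (A₀ / σ + A₁ / σ ^ 2) * (b * Real.exp (σ * t)) := by
  refine (intervalIntegral.norm_integral_le_of_norm_le (μ := volume) ht
    (g := fun s => (A₀ + (t - s) * A₁) * (b * Real.exp (σ * s)))
    (Eventually.of_forall fun s hs => hg s hs.1.le hs.2)
    (Continuous.intervalIntegrable (by fun_prop) _ _)).trans ?_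
  have e : (fun s => (A₀ + (t - s) * A₁) * (b * Real.exp (σ * s)))
      = fun s => A₀ * b * Real.exp (σ * s) + A₁ * b * ((t - s) * Real.exp (σ * s)) := by
    ext s; ring
  rw [e, intervalIntegral.integral_add (Continuous.intervalIntegrable (by fun_prop) _ _)
    (Continuous.intervalIntegrable (by fun_prop) _ _), intervalIntegral.integral_const_mul,
    intervalIntegral.integral_const_mul]
  calc _ ≤ A₀ * b * (Real.exp (σ * t) / σ) + A₁ * b * (Real.exp (σ * t) / σ ^ 2) := by
        gcongr
        · exact integral_exp_mul_le hσ
        · exact integral_sub_mul_exp_mul_le hσ ht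
    _ = _ := by ring

theorem mul_le_exp_mul_div {σ t : ℝ} (hσ : 0 < σ) : t ≤ Real.exp (σ * t) / σ := by
  rw [le_div_iff₀ hσ]
  linarith [Real.add_one_le_exp (σ * t)]

theorem add_mul_le_exp {σ t B₀ B₁ : ℝ} (hσ : 0 < σ) (ht : 0 ≤ t) (hB₀ : 0 ≤ B₀) (hB₁ : 0 ≤ B₁) :
    B₀ + t * B₁ ≤ (B₀ + B₁ / σ) * Real.exp (σ * t) := by
  have h1 : 1 ≤ Real.exp (σ * t) := Real.one_le_exp (by positivity)
  have h2 := mul_le_exp_mul_div (t := t) hσ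
  calc B₀ + t * B₁ ≤ B₀ * Real.exp (σ * t) + Real.exp (σ * t) / σ * B₁ := by
        gcongr
        exact le_mul_of_one_le_right hB₀ h1
    _ = _ := by ring

/-- A priori exponential bound for locally bounded solutions of a Volterra equation. -/
theorem volterra_norm_le_exp {K F y : ℝ → ℂ} {A₀ A₁ B₀ B₁ σ : ℝ} (hσ : 0 < σ)
    (hA₀ : 0 ≤ A₀) (hA₁ : 0 ≤ A₁) (hB₀ : 0 ≤ B₀) (hB₁ : 0 ≤ B₁)
    (hK : ∀ t, 0 ≤ t → ‖K t‖ ≤ A₀ + t * A₁) (hF : ∀ t, 0 ≤ t → ‖F t‖ ≤ B₀ + t * B₁)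
    (hyb : ∀ T : ℝ, 0 < T → ∃ B, ∀ t, 0 ≤ t → t ≤ T → ‖y t‖ ≤ B)
    (hy : ∀ t, 0 ≤ t → y t = F t + ∫ s in (0 : ℝ)..t, K (t - s) * y s)
    (hsmall : A₀ / σ + A₁ / σ ^ 2 ≤ 1 / 2) {t : ℝ} (ht : 0 ≤ t) :
    ‖y t‖ ≤ 2 * (B₀ + B₁ / σ) * Real.exp (σ * t) := by
  set T := t + 1 with hT
  obtain ⟨B, hB⟩ := hyb T (by positivity)
  set S : Set ℝ := (fun s => ‖y s‖ * Real.exp (-(σ * s))) '' Icc 0 T with hS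
  have hbdd : BddAbove S := by
    refine ⟨B, ?_⟩
    rintro _ ⟨s, hs, rfl⟩
    have h1 := hB s hs.1 hs.2
    have h2 : Real.exp (-(σ * s)) ≤ 1 := Real.exp_le_one_iff.2 (by
      have := mul_nonneg hσ.le hs.1; linarith)
    exact (mul_le_of_le_one_right (norm_nonneg _) h2).trans h1
  have hne : S.Nonempty := ⟨_, 0, ⟨le_rfl, by positivity⟩, rfl⟩
  set b := sSup S with hb
  have hmem : ∀ s, 0 ≤ s → s ≤ T → ‖y s‖ ≤ b * Real.exp (σ * s) := by
    intro s h0 h1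
    have : ‖y s‖ * Real.exp (-(σ * s)) ≤ b := le_csSup hbdd ⟨s, ⟨h0, h1⟩, rfl⟩
    rwa [Real.exp_neg, ← div_eq_mul_inv, div_le_iff₀ (Real.exp_pos _)] at this
  have hb0 : 0 ≤ b := by
    have := hmem 0 le_rfl (by positivity)
    simp only [mul_zero, Real.exp_zero, mul_one] at this
    exact (norm_nonneg _).trans this
  have hstep : b ≤ (B₀ + B₁ / σ) + 1 / 2 * b := by
    refine csSup_le hne ?_
    rintro _ ⟨s, hs, rfl⟩
    simp only
    rw [Real.exp_neg, ← div_eq_mul_inv, div_le_iff₀ (Real.exp_pos _), hy s hs.1, add_mul]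
    refine (norm_add_le _ _).trans (add_le_add ((hF s hs.1).trans
      (add_mul_le_exp hσ hs.1 hB₀ hB₁)) ?_)
    refine (norm_integral_le_exp (σ := σ) (b := b) hσ hs.1 hA₀ hA₁ hb0 fun r h0 h1 => ?_).trans ?_
    · rw [norm_mul]
      have := hK (s - r) (by linarith)
      have h3 := hmem r h0 (h1.trans hs.2)
      exact mul_le_mul this h3 (norm_nonneg _) (by
        have : 0 ≤ (s - r) * A₁ := mul_nonneg (by linarith) hA₁
        linarith)
    · rw [mul_assoc (1 / 2)]
      gcongr
  have h2b : b ≤ 2 * (B₀ + B₁ / σ) := by linarith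
  exact (hmem t ht (by linarith)).trans (by gcongr)

theorem continuousAt_volterra_integral {K y : ℝ → ℂ} (hK : Continuous K) (hym : Measurable y)
    (hyb : ∀ T : ℝ, 0 < T → ∃ B, ∀ t, 0 ≤ t → t ≤ T → ‖y t‖ ≤ B) {t : ℝ} (ht : 0 < t) :
    ContinuousAt (fun t => ∫ s in (0 : ℝ)..t, K (t - s) * y s) t := by
  obtain ⟨B, hB⟩ := hyb (t + 1) (by positivity)
  obtain ⟨A, hA⟩ := (isCompact_Icc (a := (0 : ℝ)) (b := t + 1)).exists_bound_of_continuousOn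
    hK.continuousOn
  have hev : ∀ᶠ u in 𝓝 t, 0 < u ∧ u < t + 1 := Ioo_mem_nhds ht (by linarith)
  have hB0 : 0 ≤ B := (norm_nonneg _).trans (hB 0 le_rfl (by positivity))
  have hA0 : 0 ≤ A := (norm_nonneg _).trans (hA 0 ⟨le_rfl, by positivity⟩)
  have key : ContinuousAt (fun u => ∫ s, (Ioc 0 u).indicator (fun s => K (u - s) * y s) s) t := by
    refine continuousAt_of_dominated
      (bound := (Ioc 0 (t + 1)).indicator fun _ => A * B) ?_ ?_ ?_ ?_
    · refine Eventually.of_forall fun u => ?_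
      have h : Measurable fun s => K (u - s) * y s :=
        (hK.measurable.comp (by fun_prop)).mul hym
      exact (h.indicator measurableSet_Ioc).aestronglyMeasurable
    · filter_upwards [hev] with u hu
      refine Eventually.of_forall fun s => ?_
      by_cases hs : s ∈ Ioc 0 u
      · have hs' : s ∈ Ioc 0 (t + 1) := ⟨hs.1, hs.2.trans hu.2.le⟩
        rw [indicator_of_mem hs, indicator_of_mem hs', norm_mul]
        refine mul_le_mul (hA _ ⟨by linarith [hs.2], by linarith [hs.1, hu.2]⟩)
          (hB s hs.1.le hs'.2) (norm_nonneg _) hA0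
      · rw [indicator_of_notMem hs, norm_zero]
        exact indicator_nonneg (fun _ _ => by positivity) _
    · exact (integrable_indicator_iff measurableSet_Ioc).2 (integrableOn_const (by simp))
    · have hae : ∀ᵐ s : ℝ, s ≠ t := by
        simp [ae_iff]
      filter_upwards [hae] with s hs
      have hc : ContinuousAt (fun u => K (u - s) * y s) t :=
        ((hK.comp (continuous_id.sub continuous_const)).mul continuous_const).continuousAt
      by_cases h0 : 0 < s
      · rcases lt_or_gt_of_ne hs with h | h
        · refine hc.congr ?_
          filter_upwards [Ioi_mem_nhds h] with u hu
          rw [indicator_of_mem (show s ∈ Ioc 0 u from ⟨h0, le_of_lt hu⟩)]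
        · refine (continuousAt_const (y := (0 : ℂ))).congr ?_
          filter_upwards [Iio_mem_nhds h] with u hu
          rw [indicator_of_notMem fun hm => absurd hm.2 (not_le.2 hu)]
      · refine (continuousAt_const (y := (0 : ℂ))).congr (Eventually.of_forall fun u => ?_)
        simp only
        rw [indicator_of_notMem fun hm => h0 hm.1]
  refine key.congr ?_
  filter_upwards [hev] with u hu
  rw [intervalIntegral.integral_of_le hu.1.le, integral_indicator measurableSet_Ioc]

theorem integrableOn_laplace_of_exp_bound {y : ℝ → ℂ} (hym : Measurable y) {D σ : ℝ}
    (hyb : ∀ t, 0 ≤ t → ‖y t‖ ≤ D * Real.exp (σ * t)) {lam : ℂ} (hlam : σ < lam.re) :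
    IntegrableOn (fun t : ℝ => Complex.exp (-lam * t) * y t) (Ioi 0) := by
  have hm : Measurable fun t : ℝ => Complex.exp (-lam * t) * y t := by fun_prop
  refine Integrable.mono' ((integrableOn_exp_neg (σ := lam.re - σ) (by linarith)).const_mul D)
    hm.aestronglyMeasurable ?_
  filter_upwards [ae_restrict_mem measurableSet_Ioi] with t ht
  rw [norm_mul, norm_cexp_neg_mul_ofReal]
  calc _ ≤ Real.exp (-lam.re * t) * (D * Real.exp (σ * t)) := by
        gcongr; exact hyb t (le_of_lt ht)
    _ = D * Real.exp (-(lam.re - σ) * t) := by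
        rw [mul_left_comm, ← Real.exp_add]; congr 2; ring

/-- The Laplace transform turns causal convolution into multiplication. -/
theorem laplace_volterra_integral {K y : ℝ → ℂ} {lam : ℂ}
    (hK : IntegrableOn (fun t : ℝ => Complex.exp (-lam * t) * K t) (Ioi 0))
    (hy : IntegrableOn (fun t : ℝ => Complex.exp (-lam * t) * y t) (Ioi 0)) :
    ∫ t in Ioi (0 : ℝ), Complex.exp (-lam * t) * ∫ s in (0 : ℝ)..t, K (t - s) * y s
      = (∫ t in Ioi (0 : ℝ), Complex.exp (-lam * t) * K t)
        * ∫ t in Ioi (0 : ℝ), Complex.exp (-lam * t) * y t := by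
  have := integral_posConvolution hy hK (ContinuousLinearMap.mul ℝ ℂ)
  simp only [ContinuousLinearMap.mul_apply'] at this
  rw [mul_comm, ← this]
  refine integral_congr_ae (Eventually.of_forall fun t => ?_)
  dsimp only
  rw [← intervalIntegral.integral_const_mul]
  refine intervalIntegral.integral_congr fun s _ => ?_
  have : Complex.exp (-lam * t) = Complex.exp (-lam * s) * Complex.exp (-lam * (t - s : ℝ)) := by
    rw [← Complex.exp_add]; congr 1; push_cast; ring
  rw [this]; ring

section

variable {X : Type*} [MeasurableSpace X]

section
variable {μ : Measure X} {a : X → ℝ} {k₀ k₁ f₀ f₁ : X → ℂ}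

/-- Laplace transform of `K ⋆ y` when `y = F + K ⋆ y`. -/
def volterraLaplace (μ : Measure X) (a : X → ℝ) (k₀ k₁ f₀ f₁ : X → ℂ) (z : ℂ) : ℂ :=
  imagResolvent μ a k₀ k₁ z * imagResolvent μ a f₀ f₁ z
    / (1 - imagResolvent μ a k₀ k₁ z)

theorem norm_volterraLaplace_le {c : ℝ} (hc : 0 < c) {z : ℂ}
    (h : c ≤ ‖1 - imagResolvent μ a k₀ k₁ z‖) :
    ‖volterraLaplace μ a k₀ k₁ f₀ f₁ z‖
      ≤ c⁻¹ * (‖imagResolvent μ a k₀ k₁ z‖ * ‖imagResolvent μ a f₀ f₁ z‖) := by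
  rw [volterraLaplace, norm_div, norm_mul, div_eq_inv_mul]
  gcongr

theorem differentiableAt_volterraLaplace (ha : Measurable a)
    (hk₀ : Integrable k₀ μ) (hk₁ : Integrable k₁ μ) (hf₀ : Integrable f₀ μ) (hf₁ : Integrable f₁ μ)
    {z : ℂ} (hz : 0 < z.re) (h : 1 - imagResolvent μ a k₀ k₁ z ≠ 0) :
    DifferentiableAt ℂ (volterraLaplace μ a k₀ k₁ f₀ f₁) z := by
  have h1 := differentiableAt_imagResolvent ha hk₀ hk₁ hz
  have h2 := differentiableAt_imagResolvent ha hf₀ hf₁ hz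
  exact (h1.mul h2).div ((differentiableAt_const _).sub h1) h

theorem integrable_volterraLaplace_vertical [SFinite μ] (ha : Measurable a)
    (hk₀ : Integrable k₀ μ) (hk₁ : Integrable k₁ μ) (hf₀ : Integrable f₀ μ) (hf₁ : Integrable f₁ μ)
    {σ c : ℝ} (hσ : 0 < σ) (hc : 0 < c)
    (h : ∀ w : ℝ, c ≤ ‖1 - imagResolvent μ a k₀ k₁ (σ + w * I)‖) :
    Integrable (fun w : ℝ => volterraLaplace μ a k₀ k₁ f₀ f₁ (σ + w * I)) ∧
    ∫ w : ℝ, ‖volterraLaplace μ a k₀ k₁ f₀ f₁ (σ + w * I)‖ ≤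
      c⁻¹ * (Real.pi / σ * ((∫ x, (‖k₀ x‖ + ‖k₁ x‖ / σ) ∂μ) *
          ∫ x, (‖f₀ x‖ + ‖f₁ x‖ / σ) ∂μ)) := by
  have hcont : Continuous fun w : ℝ => volterraLaplace μ a k₀ k₁ f₀ f₁ (σ + w * I) := by
    refine continuous_iff_continuousAt.2 fun w => ?_
    refine ContinuousAt.comp (x := w) (f := fun w : ℝ => (σ : ℂ) + w * I)
      (g := volterraLaplace μ a k₀ k₁ f₀ f₁) ?_
      (Continuous.continuousAt (by fun_prop))
    refine (differentiableAt_volterraLaplace ha hk₀ hk₁ hf₀ hf₁ (by simpa using hσ) ?_).continuousAt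
    exact norm_pos_iff.1 (hc.trans_le (h w))
  have hA : 0 ≤ c⁻¹ * (Real.pi / σ * ((∫ x, (‖k₀ x‖ + ‖k₁ x‖ / σ) ∂μ) *
          ∫ x, (‖f₀ x‖ + ‖f₁ x‖ / σ) ∂μ)) := by positivity
  have hle : ∫⁻ w : ℝ, ‖volterraLaplace μ a k₀ k₁ f₀ f₁ (σ + w * I)‖ₑ ≤
      ENNReal.ofReal (c⁻¹ * (Real.pi / σ * ((∫ x, (‖k₀ x‖ + ‖k₁ x‖ / σ) ∂μ) *
          ∫ x, (‖f₀ x‖ + ‖f₁ x‖ / σ) ∂μ))) := by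
    calc _ ≤ ∫⁻ w : ℝ, ENNReal.ofReal c⁻¹ * (‖imagResolvent μ a k₀ k₁ (σ + w * I)‖ₑ *
        ‖imagResolvent μ a f₀ f₁ (σ + w * I)‖ₑ) := by
          refine lintegral_mono fun w => ?_
          dsimp only
          rw [← ofReal_norm, ← ofReal_norm, ← ofReal_norm, ← ENNReal.ofReal_mul (norm_nonneg _),
            ← ENNReal.ofReal_mul (inv_nonneg.2 hc.le)]
          exact ENNReal.ofReal_le_ofReal (norm_volterraLaplace_le hc (h w))
      _ ≤ _ := by
          rw [lintegral_const_mul' _ _ ENNReal.ofReal_ne_top,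
            ENNReal.ofReal_mul (inv_nonneg.2 hc.le)]
          gcongr
          exact lintegral_imagResolvent_mul_le ha hk₀ hk₁ hf₀ hf₁ hσ
  refine ⟨⟨hcont.aestronglyMeasurable, hle.trans_lt ENNReal.ofReal_lt_top⟩, ?_⟩
  rw [integral_norm_eq_lintegral_enorm hcont.aestronglyMeasurable]
  exact ENNReal.toReal_le_of_le_ofReal hA hle

/-- Solutions of the Volterra equation `y = F + K ⋆ y` grow like `e^{σt}` as soon as
`1 - K̂` is bounded away from zero on `Re λ ≥ σ`. -/
theorem volterra_sub_norm_le [SFinite μ] (ha : Measurable a)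
    (hk₀ : Integrable k₀ μ) (hk₁ : Integrable k₁ μ) (hf₀ : Integrable f₀ μ) (hf₁ : Integrable f₁ μ)
    {σ c : ℝ} (hσ : 0 < σ) (hc : 0 < c)
    (hlow : ∀ z : ℂ, σ ≤ z.re → c ≤ ‖1 - imagResolvent μ a k₀ k₁ z‖)
    {y : ℝ → ℂ} (hym : Measurable y)
    (hyb : ∀ T : ℝ, 0 < T → ∃ B, ∀ t, 0 ≤ t → t ≤ T → ‖y t‖ ≤ B)
    (hy : ∀ t, 0 ≤ t → y t = waveTransform μ a f₀ f₁ t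
      + ∫ s in (0 : ℝ)..t, waveTransform μ a k₀ k₁ (t - s) * y s) {t : ℝ} (ht : 0 ≤ t) :
    ‖y t - waveTransform μ a f₀ f₁ t‖ ≤ (2 * c * σ)⁻¹ * ((∫ x, (‖k₀ x‖ + ‖k₁ x‖ / σ) ∂μ) *
          ∫ x, (‖f₀ x‖ + ‖f₁ x‖ / σ) ∂μ) * Real.exp (σ * t) := by
  rcases ht.eq_or_lt with rfl | ht
  · rw [hy 0 le_rfl, intervalIntegral.integral_same, add_zero, sub_self, norm_zero]
    positivity
  set K := waveTransform μ a k₀ k₁ with hKdef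
  set F := waveTransform μ a f₀ f₁ with hFdef
  set G : ℝ → ℂ := fun t => ∫ s in (0 : ℝ)..t, K (t - s) * y s with hG
  set H := volterraLaplace μ a k₀ k₁ f₀ f₁ with hH
  have hKc : Continuous K := continuous_waveTransform ha hk₀ hk₁
  have hFc : Continuous F := continuous_waveTransform ha hf₀ hf₁
  have hKb : ∀ t, 0 ≤ t → ‖K t‖ ≤ ∫ x, ‖k₀ x‖ ∂μ + t * ∫ x, ‖k₁ x‖ ∂μ := fun t ht => by
    simpa [abs_of_nonneg ht] using norm_waveTransform_le (a := a) hk₀ hk₁ t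
  have hFb : ∀ t, 0 ≤ t → ‖F t‖ ≤ ∫ x, ‖f₀ x‖ ∂μ + t * ∫ x, ‖f₁ x‖ ∂μ := fun t ht => by
    simpa [abs_of_nonneg ht] using norm_waveTransform_le (a := a) hf₀ hf₁ t
  obtain ⟨σ₁, hσ₁, hsmall⟩ : ∃ σ₁, σ ≤ σ₁ ∧
      (∫ x, ‖k₀ x‖ ∂μ) / σ₁ + (∫ x, ‖k₁ x‖ ∂μ) / σ₁ ^ 2 ≤ 1 / 2 := by
    have h1 : Tendsto (fun s : ℝ => (∫ x, ‖k₀ x‖ ∂μ) / s + (∫ x, ‖k₁ x‖ ∂μ) / s ^ 2) atTop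
        (𝓝 (0 + 0)) :=
      (tendsto_const_nhds.div_atTop tendsto_id).add
        (tendsto_const_nhds.div_atTop (tendsto_pow_atTop two_ne_zero))
    rw [add_zero] at h1
    obtain ⟨s, hs1, hs2⟩ := ((eventually_ge_atTop σ).and
      (h1.eventually (ge_mem_nhds (by norm_num : (0 : ℝ) < 1 / 2)))).exists
    exact ⟨s, hs1, hs2⟩
  have hσ₁0 : 0 < σ₁ := hσ.trans_le hσ₁
  have hyexp := fun t (ht : 0 ≤ t) => volterra_norm_le_exp hσ₁0
    (integral_nonneg fun _ => norm_nonneg _) (integral_nonneg fun _ => norm_nonneg _)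
    (integral_nonneg fun _ => norm_nonneg _) (integral_nonneg fun _ => norm_nonneg _)
    hKb hFb hyb hy hsmall ht
  set σ₂ := σ₁ + 1 with hσ₂
  have hσ₂0 : 0 < σ₂ := by linarith
  have hyL : ∀ z : ℂ, z.re = σ₂ →
      IntegrableOn (fun t : ℝ => Complex.exp (-z * t) * y t) (Ioi 0) := fun z hz =>
    integrableOn_laplace_of_exp_bound hym hyexp (by linarith)
  have hFL := fun z (hz : z.re = σ₂) =>
    laplace_waveTransform (lam := z) ha hf₀ hf₁ (by rw [hz]; exact hσ₂0)
  have hKL := fun z (hz : z.re = σ₂) =>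
    laplace_waveTransform (lam := z) ha hk₀ hk₁ (by rw [hz]; exact hσ₂0)
  have hGeq : ∀ z : ℂ, EqOn (fun t : ℝ => Complex.exp (-z * t) * G t)
      (fun t : ℝ => Complex.exp (-z * t) * y t - Complex.exp (-z * t) * F t) (Ioi 0) := by
    intro z s hs
    dsimp only
    rw [hy s (le_of_lt hs)]
    ring
  have hGL : ∀ z : ℂ, z.re = σ₂ →
      IntegrableOn (fun t : ℝ => Complex.exp (-z * t) * G t) (Ioi 0) := fun z hz =>
    ((hyL z hz).sub (hFL z hz).1).congr_fun (hGeq z).symm measurableSet_Ioi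
  have hGH : ∀ z : ℂ, z.re = σ₂ → ∫ s in Ioi (0 : ℝ), Complex.exp (-z * s) * G s = H z := by
    intro z hz
    have e1 : ∫ s in Ioi (0 : ℝ), Complex.exp (-z * s) * G s
        = (∫ s in Ioi (0 : ℝ), Complex.exp (-z * s) * y s) - imagResolvent μ a f₀ f₁ z := by
      rw [setIntegral_congr_fun measurableSet_Ioi (hGeq z), integral_sub (hyL z hz) (hFL z hz).1,
        (hFL z hz).2]
    have e2 : ∫ s in Ioi (0 : ℝ), Complex.exp (-z * s) * G s
        = imagResolvent μ a k₀ k₁ z * ∫ s in Ioi (0 : ℝ), Complex.exp (-z * s) * y s := by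
      rw [← (hKL z hz).2]
      exact laplace_volterra_integral (hKL z hz).1 (hyL z hz)
    have hne : 1 - imagResolvent μ a k₀ k₁ z ≠ 0 :=
      norm_pos_iff.1 (hc.trans_le (hlow z (by linarith)))
    rw [hH, volterraLaplace, eq_div_iff hne]
    linear_combination (1 : ℂ) * e2 - imagResolvent μ a k₀ k₁ z * e1
  have hline := fun s (hs : σ ≤ s) => integrable_volterraLaplace_vertical ha hk₀ hk₁ hf₀ hf₁
    (hσ.trans_le hs) hc fun w => hlow (s + w * I) (by simpa using hs)
  have hσσ₂ : σ ≤ σ₂ := by linarith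
  have hinv : G t = (2 * Real.pi : ℂ)⁻¹ * ∫ w : ℝ, Complex.exp ((σ₂ + w * I) * t)
      * H (σ₂ + w * I) :=
    laplace_inversion ht (continuousAt_volterra_integral hKc hym hyb ht)
      (by simpa using hGL σ₂ (by simp)) (fun w => hGH _ (by simp)) (hline σ₂ hσσ₂).1
  have hnexp : ∀ (s w : ℝ), ‖Complex.exp ((s + w * I) * t)‖ = Real.exp (s * t) := by
    intro s w
    rw [Complex.norm_exp]
    simp
  have hI_int : ∀ s, σ ≤ s → Integrable fun w : ℝ => Complex.exp ((s + w * I) * t)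
      * H (s + w * I) := by
    intro s hs
    refine ((hline s hs).1.bdd_mul (c := Real.exp (s * t)) (by fun_prop) ?_)
    exact Eventually.of_forall fun w => (hnexp s w).le
  have hdecay : ∀ (l : Filter ℝ) [l.IsCountablyGenerated], Tendsto (fun T : ℝ => |T|) l atTop →
      ∀ s, σ ≤ s →
        Tendsto (fun T : ℝ => Complex.exp ((s + T * I) * t) * H (s + T * I)) l (𝓝 0) := by
    intro l _ hl s hs
    have h1 := tendsto_imagResolvent_vertical ha hk₀ hk₁ (hσ.trans_le hs) hl
    have h2 := tendsto_imagResolvent_vertical ha hf₀ hf₁ (hσ.trans_le hs) hl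
    have h3 : Tendsto (fun T : ℝ => H (s + T * I)) l (𝓝 (0 * 0 / (1 - 0))) :=
      (h1.mul h2).div (tendsto_const_nhds.sub h1) (by simp)
    rw [mul_zero, zero_div] at h3
    refine squeeze_zero_norm (a := fun T : ℝ => Real.exp (s * t) * ‖H (s + T * I)‖) (fun T => ?_) ?_
    · rw [norm_mul, hnexp]
    · simpa using h3.norm.const_mul (Real.exp (s * t))
  have hshift : ∫ w : ℝ, Complex.exp ((σ + w * I) * t) * H (σ + w * I)
      = ∫ w : ℝ, Complex.exp ((σ₂ + w * I) * t) * H (σ₂ + w * I) := by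
    refine integral_vertical_eq (f := fun z => Complex.exp (z * t) * H z) hσσ₂ ?_ (hI_int σ le_rfl)
      (hI_int σ₂ hσσ₂) (B := Real.exp (σ₂ * t) * (c⁻¹ * ((σ⁻¹ * ∫ x, (‖k₀ x‖ + ‖k₁ x‖ / σ) ∂μ) *
        (σ⁻¹ * ∫ x, (‖f₀ x‖ + ‖f₁ x‖ / σ) ∂μ)))) ?_
      (hdecay atTop tendsto_abs_atTop_atTop) (hdecay atBot tendsto_abs_atBot_atTop)
    · intro z hz
      refine DifferentiableAt.mul (by fun_prop) ?_
      exact differentiableAt_volterraLaplace ha hk₀ hk₁ hf₀ hf₁ (hσ.trans_le hz)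
        (norm_pos_iff.1 (hc.trans_le (hlow z hz)))
    · intro z hz hz2
      rw [norm_mul, Complex.norm_exp]
      have hre : (z * t).re = z.re * t := by simp
      rw [hre]
      refine mul_le_mul (Real.exp_le_exp.2 (by gcongr)) ((norm_volterraLaplace_le hc
        (hlow z hz)).trans ?_) (norm_nonneg _) (Real.exp_nonneg _)
      gcongr
      · exact norm_imagResolvent_le hk₀ hk₁ hσ hz
      · exact norm_imagResolvent_le hf₀ hf₁ hσ hz
  have hyG : y t - F t = G t := by rw [hy t ht.le]; ring
  rw [hyG, hinv, ← hshift, norm_mul]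
  have hpi : ‖(2 * Real.pi : ℂ)⁻¹‖ = (2 * Real.pi)⁻¹ := by
    rw [norm_inv, norm_mul]
    simp [abs_of_pos Real.pi_pos]
  rw [hpi]
  calc _ ≤ (2 * Real.pi)⁻¹ * ∫ w : ℝ, ‖Complex.exp ((σ + w * I) * t) * H (σ + w * I)‖ := by
        gcongr; exact norm_integral_le_integral_norm _
    _ = (2 * Real.pi)⁻¹ * (Real.exp (σ * t) * ∫ w : ℝ, ‖H (σ + w * I)‖) := by
        simp_rw [norm_mul, hnexp]
        rw [integral_const_mul]
    _ ≤ (2 * Real.pi)⁻¹ * (Real.exp (σ * t) * (c⁻¹ * (Real.pi / σ *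
          ((∫ x, (‖k₀ x‖ + ‖k₁ x‖ / σ) ∂μ) * ∫ x, (‖f₀ x‖ + ‖f₁ x‖ / σ) ∂μ)))) := by
        gcongr
        exact (hline σ le_rfl).2
    _ = _ := by
        have := Real.pi_pos.ne'
        field_simp

end

end

/-- A jointly continuous family of functions, holomorphic on `Re ν > 0`, which avoids the value
`b ≠ 0` on `Re ν > γ₀` for parameters in `S`, stays uniformly away from `b` on `Re ν ≥ γ > γ₀`. -/
theorem exists_pos_le_norm_sub_of_forall_ne {Θ : Type*} [MetricSpace Θ] {L : Θ → ℂ → ℂ}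
    {S K : Set Θ} (hK : IsCompact K) (hSK : S ⊆ K) {γ₀ γ : ℝ} (hγ₀ : 0 ≤ γ₀) (hγ : γ₀ < γ)
    {b : ℂ} (hb : b ≠ 0)
    (hcont : ∀ θ ν, 0 < ν.re → ContinuousAt (Function.uncurry L) (θ, ν))
    (hdiff : ∀ θ ν, 0 < ν.re → DifferentiableAt ℂ (L θ) ν)
    (hdecay : ∀ (θ : ℕ → Θ) (ν : ℕ → ℂ), (∀ k, θ k ∈ K) → (∀ k, γ ≤ (ν k).re) →
      Tendsto (fun k => ‖ν k‖) atTop atTop → Tendsto (fun k => L (θ k) (ν k)) atTop (𝓝 0))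
    (hne : ∀ θ ∈ S, ∀ ν : ℂ, γ₀ < ν.re → L θ ν ≠ b) :
    ∃ c > 0, ∀ θ ∈ S, ∀ ν : ℂ, γ ≤ ν.re → c ≤ ‖b - L θ ν‖ := by
  by_contra! hcon
  choose θ hθ ν hν hlt using fun k : ℕ => hcon (1 / ((k : ℝ) + 1)) (by positivity)
  have hlim : Tendsto (fun k => L (θ k) (ν k)) atTop (𝓝 b) := by
    rw [tendsto_iff_norm_sub_tendsto_zero]
    refine squeeze_zero (fun _ => norm_nonneg _) (fun k => ?_)
      (tendsto_one_div_add_atTop_nhds_zero_nat (𝕜 := ℝ))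
    rw [norm_sub_rev]
    exact (hlt k).le
  by_cases hinf : Tendsto (fun k => ‖ν k‖) atTop atTop
  · exact hb (tendsto_nhds_unique hlim (hdecay θ ν (fun k => hSK (hθ k)) hν hinf))
  obtain ⟨R, hR⟩ : ∃ R, ∃ᶠ k in atTop, ‖ν k‖ < R := by
    rw [tendsto_atTop] at hinf
    push Not at hinf
    simpa using hinf
  have hcl : IsCompact (Metric.closedBall (0 : ℂ) R ∩ {z : ℂ | γ ≤ z.re}) :=
    (isCompact_closedBall _ _).inter_right (isClosed_le continuous_const Complex.continuous_re)
  obtain ⟨⟨θ', ν'⟩, ⟨-, -, hν'⟩, φ, hφ, hφlim⟩ := (hK.prod hcl).tendsto_subseq'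
    (x := fun k => (θ k, ν k)) (hR.mono fun k hk => ⟨hSK (hθ k), by simpa using hk.le, hν k⟩)
  have hν' : γ ≤ ν'.re := hν'
  have hγpos : 0 < γ := hγ₀.trans_lt hγ
  have hlimφ := hlim.comp hφ.tendsto_atTop
  have hval : L θ' ν' = b :=
    tendsto_nhds_unique ((hcont θ' ν' (hγpos.trans_le hν')).tendsto.comp hφlim) hlimφ
  set U : Set ℂ := {z | γ₀ < z.re} with hU
  have hUo : IsOpen U := isOpen_lt continuous_const Complex.continuous_re
  have hUconv : Convex ℝ U := convex_halfSpace_re_gt γ₀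
  have hanal : AnalyticOnNhd ℂ (fun z => L θ' z - b) U :=
    DifferentiableOn.analyticOnNhd (fun z hz =>
      ((hdiff θ' z (hγ₀.trans_lt hz)).sub_const b).differentiableWithinAt) hUo
  have hν'U : ν' ∈ U := hγ.trans_le hν'
  have hiso : ∀ᶠ z in 𝓝[≠] ν', L θ' z - b ≠ 0 := by
    refine ((hanal ν' hν'U).eventually_eq_zero_or_eventually_ne_zero).resolve_left fun h0 => ?_
    have hzero := hanal.eqOn_zero_of_preconnected_of_eventuallyEq_zero hUconv.isPreconnected hν'U h0
    have hK' : θ' ∈ K := hK.isClosed.mem_of_tendsto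
      ((continuous_fst.tendsto _).comp hφlim) (Eventually.of_forall fun k => hSK (hθ _))
    have h1 := hdecay (fun _ => θ') (fun k => ((γ + k : ℝ) : ℂ)) (fun _ => hK') (fun k => by
      simp) (by
        refine tendsto_atTop_mono (fun k : ℕ => ?_) tendsto_natCast_atTop_atTop
        rw [Complex.norm_real, Real.norm_eq_abs]
        exact le_trans (by linarith) (le_abs_self _))
    refine hb (tendsto_nhds_unique (tendsto_const_nhds.congr fun k => ?_) h1)
    have : L θ' ((γ + k : ℝ) : ℂ) - b = 0 := hzero (by
      simp only [hU, mem_ofPred_eq, Complex.ofReal_re]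
      have : (0 : ℝ) ≤ k := k.cast_nonneg
      linarith)
    exact (sub_eq_zero.1 this).symm
  rw [eventually_nhdsWithin_iff] at hiso
  obtain ⟨r, hr, hball⟩ := Metric.nhds_basis_closedBall.mem_iff.1
    (inter_mem hiso (hUo.mem_nhds hν'U))
  have hsph : ∀ z ∈ Metric.sphere ν' r, 0 < ‖L θ' z - b‖ := fun z hz => norm_pos_iff.2 <|
    (hball (Metric.sphere_subset_closedBall hz)).1 fun h => by
      rw [mem_singleton_iff.1 h, mem_sphere_iff_norm, sub_self, norm_zero] at hz
      exact hr.ne hz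
  have hsphU : Metric.sphere ν' r ⊆ U := fun z hz =>
    (hball (Metric.sphere_subset_closedBall hz)).2
  have hcs : ContinuousOn (fun z => ‖L θ' z - b‖) (Metric.sphere ν' r) := fun z hz =>
    ((hdiff θ' z (hγ₀.trans_lt (hsphU hz))).continuousAt.sub
      continuousAt_const).norm.continuousWithinAt
  obtain ⟨z₀, hz₀, hmin⟩ := (isCompact_sphere ν' r).exists_isMinOn
    (NormedSpace.sphere_nonempty.2 hr.le) hcs
  set δ := ‖L θ' z₀ - b‖ / 2 with hδ
  have hδpos : 0 < δ := half_pos (hsph z₀ hz₀)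
  have hunif : ∀ᶠ η in 𝓝 θ', ∀ z ∈ Metric.sphere ν' r, δ < ‖L η z - b‖ := by
    refine (isCompact_sphere ν' r).eventually_forall_of_forall_eventually fun z hz => ?_
    have hc : ContinuousAt (fun p : Θ × ℂ => ‖Function.uncurry L p - b‖) (θ', z) :=
      ((hcont θ' z (hγ₀.trans_lt (hsphU hz))).sub_const b).norm
    have hgt : δ < ‖Function.uncurry L (θ', z) - b‖ := by
      have : ‖L θ' z₀ - b‖ ≤ ‖L θ' z - b‖ := hmin hz
      change δ < ‖L θ' z - b‖
      linarith
    exact hc.eventually (lt_mem_nhds hgt)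
  have hfin : ∀ᶠ k in atTop, δ ≤ ‖L (θ (φ k)) (ν (φ k)) - b‖ := by
    filter_upwards [((continuous_fst.tendsto _).comp hφlim).eventually hunif,
      ((continuous_snd.tendsto _).comp hφlim).eventually (Metric.ball_mem_nhds ν' hr)] with k hk hk'
    have hk : ∀ z ∈ Metric.sphere ν' r, δ < ‖L (θ (φ k)) z - b‖ := hk
    have hk' : ν (φ k) ∈ Metric.ball ν' r := hk'
    have hd : DiffContOnCl ℂ (fun z => (L (θ (φ k)) z - b)⁻¹) (Metric.ball ν' r) := by
      refine DifferentiableOn.diffContOnCl fun z hz => ?_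
      rw [closure_ball _ hr.ne'] at hz
      have hzU : z ∈ U := (hball hz).2
      exact (((hdiff _ z (hγ₀.trans_lt hzU)).sub_const b).inv
        (sub_ne_zero.2 (hne _ (hθ _) z hzU))).differentiableWithinAt
    have := Complex.norm_le_of_forall_mem_frontier_norm_le Metric.isBounded_ball hd (C := δ⁻¹)
      (fun z hz => by
        rw [frontier_ball _ hr.ne'] at hz
        rw [norm_inv]
        exact inv_anti₀ hδpos (hk z hz).le) (subset_closure hk')
    rw [norm_inv] at this
    refine (inv_le_inv₀ ?_ hδpos).1 this
    exact norm_pos_iff.2 (sub_ne_zero.2 (hne _ (hθ _) _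
      (hball (Metric.ball_subset_closedBall hk')).2))
  have hto : Tendsto (fun k => ‖L (θ (φ k)) (ν (φ k)) - b‖) atTop (𝓝 0) :=
    tendsto_iff_norm_sub_tendsto_zero.1 hlimφ
  exact absurd (ge_of_tendsto hto hfin) (not_le.2 hδpos)

section
variable {d m : ℕ} {μ : Measure (Fin d → ℝ)} {Φ : (Fin d → ℝ) → (Fin m → ℂ)}

/-- The vector-valued integral behind the dispersion function, for a real direction `e`. -/
def dispersionVec (μ : Measure (Fin d → ℝ)) (Φ : (Fin d → ℝ) → (Fin m → ℂ)) (e : Fin d → ℝ)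
    (ν : ℂ) : Fin m → ℂ :=
  imagResolvent μ (fun w => ∑ j, e j * w j) (fun w => -I • fderiv ℝ Φ w e) (fun w => -Φ w) ν

/-- The dispersion function for a real direction `e` and a functional `p`. -/
def dispersion (μ : Measure (Fin d → ℝ)) (Φ : (Fin d → ℝ) → (Fin m → ℂ))
    (θ : ((Fin m → ℂ) →L[ℂ] ℂ) × (Fin d → ℝ)) (ν : ℂ) : ℂ :=
  I * θ.1 (dispersionVec μ Φ θ.2 ν)

theorem fderiv_int_direction (n : Fin d → ℤ) (w : Fin d → ℝ) :
    ∑ j, (n j : ℂ) • fderiv ℝ Φ w (Pi.single j 1) = fderiv ℝ Φ w (fun j => (n j : ℝ)) := by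
  have h : (fun j => (n j : ℝ)) = ∑ j, (n j : ℝ) • (Pi.single j (1 : ℝ) : Fin d → ℝ) := by
    ext i
    simp [Finset.sum_apply, Pi.single_apply]
  rw [h, map_sum]
  refine Finset.sum_congr rfl fun j _ => ?_
  rw [map_smul]
  ext i
  simp

theorem znorm_sq (n : Fin d → ℤ) : znorm n ^ 2 = ∑ j, ((n j : ℝ)) ^ 2 :=
  Real.sq_sqrt (Finset.sum_nonneg fun _ _ => sq_nonneg _)

theorem abs_le_znorm (n : Fin d → ℤ) (j : Fin d) : |(n j : ℝ)| ≤ znorm n := by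
  refine Real.abs_le_sqrt ?_
  exact Finset.single_le_sum (f := fun j => ((n j : ℝ)) ^ 2) (fun _ _ => sq_nonneg _)
    (Finset.mem_univ j)

theorem znorm_pos {n : Fin d → ℤ} (hn : n ≠ 0) : 0 < znorm n := by
  obtain ⟨j, hj⟩ := Function.ne_iff.1 hn
  exact (abs_pos.2 (Int.cast_ne_zero.2 hj)).trans_le (abs_le_znorm n j)

theorem Lam_eq_dispersion (p : (Fin m → ℂ) →L[ℂ] ℂ) {n : Fin d → ℤ} (hn : n ≠ 0) (ν : ℂ) :
    Lam μ Φ p n (znorm n * ν) = dispersion μ Φ (p, fun j => (n j : ℝ) / znorm n) ν := by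
  have hN : (znorm n : ℂ) ≠ 0 := Complex.ofReal_ne_zero.2 (znorm_pos hn).ne'
  rw [Lam, dispersion, dispersionVec, imagResolvent]
  congr 3
  ext1 w
  have hdir : fderiv ℝ Φ w (fun j => (n j : ℝ) / znorm n)
      = (znorm n : ℂ)⁻¹ • ∑ j, (n j : ℂ) • fderiv ℝ Φ w (Pi.single j 1) := by
    rw [fderiv_int_direction]
    have : (fun j => (n j : ℝ) / znorm n) = (znorm n)⁻¹ • fun j => (n j : ℝ) := by
      ext j; simp [div_eq_inv_mul]
    rw [this, map_smul]
    ext i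
    simp
  have hdot : ((∑ j, (n j : ℝ) / znorm n * w j : ℝ) : ℂ) = (znorm n : ℂ)⁻¹ * (zdot n w : ℂ) := by
    rw [zdot, ← Complex.ofReal_inv, ← Complex.ofReal_mul, Finset.mul_sum]
    congr 1
    exact Finset.sum_congr rfl fun j _ => by ring
  have hres : ν + I * ((znorm n : ℂ)⁻¹ * (zdot n w : ℂ))
      = (znorm n : ℂ)⁻¹ * (znorm n * ν + I * zdot n w) := by
    field_simp
  have hsq : ((∑ j, ((n j : ℝ)) ^ 2 : ℝ) : ℂ) = (znorm n : ℂ) ^ 2 := by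
    rw [← znorm_sq]; push_cast; rfl
  dsimp only
  rw [hdir, hdot, hres, hsq, mul_inv, inv_inv, add_comm]
  simp only [smul_smul, smul_neg]
  rw [← neg_smul]
  congr 2
  · field_simp
  · rw [div_eq_mul_inv, mul_pow, inv_pow]; ring

theorem aestronglyMeasurable_dispersion_integrand (hΦ : Integrable Φ μ)
    (hDΦ : Integrable (fun w => fderiv ℝ Φ w) μ) (e : Fin d → ℝ) (ν : ℂ) :
    AEStronglyMeasurable (fun x : Fin d → ℝ =>
      (ν + I * (∑ j, e j * x j : ℝ))⁻¹ • (-I • fderiv ℝ Φ x e)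
        + ((ν + I * (∑ j, e j * x j : ℝ))⁻¹ ^ 2) • (-Φ x)) μ :=
  aestronglyMeasurable_resolvent_integrand
    (show Measurable fun x : Fin d → ℝ => ∑ j, e j * x j by fun_prop)
    ((hDΦ.apply_continuousLinearMap e).aestronglyMeasurable.fun_const_smul (-I))
    hΦ.aestronglyMeasurable.neg ν

theorem continuousAt_dispersionVec (hΦ : Integrable Φ μ)
    (hDΦ : Integrable (fun w => fderiv ℝ Φ w) μ)
    (e : Fin d → ℝ) {ν : ℂ} (hν : 0 < ν.re) :
    ContinuousAt (Function.uncurry (dispersionVec μ Φ)) (e, ν) := by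
  have hσ : 0 < ν.re / 2 := half_pos hν
  have hev : ∀ᶠ p : (Fin d → ℝ) × ℂ in 𝓝 (e, ν), ‖p.1‖ < ‖e‖ + 1 ∧ ν.re / 2 < p.2.re := by
    refine Eventually.and ?_ ?_
    · exact continuous_fst.norm.continuousAt.eventually_lt_const (by simp)
    · exact (Complex.continuous_re.comp continuous_snd).continuousAt.eventually_const_lt
        (by simpa using hν)
  set F : (Fin d → ℝ) × ℂ → (Fin d → ℝ) → (Fin m → ℂ) := fun p x =>
      (p.2 + I * (∑ j, p.1 j * x j : ℝ))⁻¹ • (-I • fderiv ℝ Φ x p.1)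
        + ((p.2 + I * (∑ j, p.1 j * x j : ℝ))⁻¹ ^ 2) • (-Φ x) with hF
  have hm : ∀ p, AEStronglyMeasurable (F p) μ := fun p =>
    aestronglyMeasurable_dispersion_integrand hΦ hDΦ p.1 p.2
  suffices key : ContinuousAt (fun p => ∫ x, F p x ∂μ) (e, ν) from key
  refine continuousAt_of_dominated
    (bound := fun x => (ν.re / 2)⁻¹ * (‖fderiv ℝ Φ x‖ * (‖e‖ + 1) + ‖Φ x‖ / (ν.re / 2)))
    (Eventually.of_forall hm) ?_ ?_ ?_
  · filter_upwards [hev] with p hp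
    refine Eventually.of_forall fun x => ?_
    refine (norm_resolvent_integrand_le' hσ hp.2.le _ _ _).trans ?_
    rw [norm_neg, norm_smul, norm_neg, Complex.norm_I, one_mul]
    gcongr
    exact (ContinuousLinearMap.le_opNorm _ _).trans (by gcongr; exact hp.1.le)
  · exact ((hDΦ.norm.mul_const _).add (hΦ.norm.div_const _)).const_mul _
  · refine Eventually.of_forall fun x => ?_
    have hden : ContinuousAt (fun p : (Fin d → ℝ) × ℂ =>
        (p.2 + I * (∑ j, p.1 j * x j : ℝ))⁻¹) (e, ν) := by
      refine ContinuousAt.inv₀ (Continuous.continuousAt (by fun_prop)) ?_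
      exact add_I_mul_ne_zero hν _
    refine ContinuousAt.add (hden.smul (Continuous.continuousAt (by fun_prop)))
      ((hden.pow 2).smul continuousAt_const)

theorem tendsto_dispersionVec (hΦ : Integrable Φ μ) (hDΦ : Integrable (fun w => fderiv ℝ Φ w) μ)
    {γ : ℝ} (hγ : 0 < γ) {e : ℕ → Fin d → ℝ} {ν : ℕ → ℂ} (he : ∀ k, ‖e k‖ ≤ 1)
    (hν : ∀ k, γ ≤ (ν k).re) (hinf : Tendsto (fun k => ‖ν k‖) atTop atTop) :
    Tendsto (fun k => dispersionVec μ Φ (e k) (ν k)) atTop (𝓝 0) := by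
  have h0 : (0 : Fin m → ℂ) = ∫ _ : Fin d → ℝ, (0 : Fin m → ℂ) ∂μ := by simp
  rw [h0]
  set F : ℕ → (Fin d → ℝ) → (Fin m → ℂ) := fun k x =>
      (ν k + I * (∑ j, e k j * x j : ℝ))⁻¹ • (-I • fderiv ℝ Φ x (e k))
        + ((ν k + I * (∑ j, e k j * x j : ℝ))⁻¹ ^ 2) • (-Φ x) with hF
  suffices key : Tendsto (fun k => ∫ x, F k x ∂μ) atTop (𝓝 (∫ _, 0 ∂μ)) from key
  refine tendsto_integral_of_dominated_convergence
    (fun x => γ⁻¹ * (‖fderiv ℝ Φ x‖ + ‖Φ x‖ / γ)) (fun k => ?_) ?_ (fun k => ?_) ?_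
  · exact aestronglyMeasurable_dispersion_integrand hΦ hDΦ (e k) (ν k)
  · exact (hDΦ.norm.add (hΦ.norm.div_const _)).const_mul _
  · refine Eventually.of_forall fun x => ?_
    refine (norm_resolvent_integrand_le' hγ (hν k) _ _ _).trans ?_
    rw [norm_neg, norm_smul, norm_neg, Complex.norm_I, one_mul]
    gcongr
    exact (ContinuousLinearMap.le_opNorm _ _).trans (mul_le_of_le_one_right (norm_nonneg _) (he k))
  · refine Eventually.of_forall fun x => ?_
    have hden : Tendsto (fun k => ‖ν k + I * (∑ j, e k j * x j : ℝ)‖) atTop atTop := by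
      refine tendsto_atTop_mono (fun k => ?_) (tendsto_atTop_add_const_right atTop
        (-(∑ j, |x j|)) hinf)
      have h1 : ‖I * ((∑ j, e k j * x j : ℝ) : ℂ)‖ ≤ ∑ j, |x j| := by
        rw [norm_mul, Complex.norm_I, one_mul, Complex.norm_real, Real.norm_eq_abs]
        refine (Finset.abs_sum_le_sum_abs _ _).trans (Finset.sum_le_sum fun j _ => ?_)
        rw [abs_mul]
        exact mul_le_of_le_one_left (abs_nonneg _) ((norm_le_pi_norm (e k) j).trans (he k))
      have h2 := norm_sub_le_norm_add (ν k) (I * ((∑ j, e k j * x j : ℝ) : ℂ))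
      linarith
    have hinv := hden.inv_tendsto_atTop
    refine squeeze_zero_norm (fun k => ?_) (?_ : Tendsto (fun k =>
      ‖ν k + I * (∑ j, e k j * x j : ℝ)‖⁻¹ * (‖fderiv ℝ Φ x‖ + ‖Φ x‖ / γ)) atTop (𝓝 0))
    · refine (norm_resolvent_integrand_le hγ (hν k) _ _ _).trans ?_
      rw [norm_neg, norm_smul, norm_neg, Complex.norm_I, one_mul, norm_inv]
      gcongr
      exact (ContinuousLinearMap.le_opNorm _ _).trans
        (mul_le_of_le_one_right (norm_nonneg _) (he k))
    · simpa using hinv.mul_const (‖fderiv ℝ Φ x‖ + ‖Φ x‖ / γ)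

/-- Penrose-type stability with a margin is uniform over the modes. -/
theorem exists_pos_le_norm_I_sub_Lam (hΦ : Integrable Φ μ)
    (hDΦ : Integrable (fun w => fderiv ℝ Φ w) μ)
    {P : (Fin d → ℤ) → ((Fin m → ℂ) →L[ℂ] ℂ)} {M : ℝ} (hP : ∀ n, ‖P n‖ ≤ M)
    {γ₀ : ℝ} (hγ₀ : 0 ≤ γ₀)
    (hstab : ∀ n : Fin d → ℤ, n ≠ 0 → ∀ lam : ℂ,
      γ₀ * znorm n < lam.re → Lam μ Φ (P n) n lam ≠ Complex.I)
    {γ : ℝ} (hγ : γ₀ < γ) :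
    ∃ c > 0, ∀ n : Fin d → ℤ, n ≠ 0 → ∀ lam : ℂ, γ * znorm n ≤ lam.re →
      c ≤ ‖I - Lam μ Φ (P n) n lam‖ := by
  have hγpos : 0 < γ := hγ₀.trans_lt hγ
  have : ProperSpace ((Fin m → ℂ) →L[ℂ] ℂ) := FiniteDimensional.proper ℂ _
  suffices key : ∃ c > 0, ∀ θ ∈ {θ : ((Fin m → ℂ) →L[ℂ] ℂ) × (Fin d → ℝ) |
      ∃ n : Fin d → ℤ, n ≠ 0 ∧ θ = (P n, fun j => (n j : ℝ) / znorm n)}, ∀ ν : ℂ, γ ≤ ν.re →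
      c ≤ ‖I - dispersion μ Φ θ ν‖ by
    obtain ⟨c, hc, h⟩ := key
    refine ⟨c, hc, fun n hn lam hlam => ?_⟩
    have hN := znorm_pos hn
    have hNc : (znorm n : ℂ) ≠ 0 := Complex.ofReal_ne_zero.2 hN.ne'
    have h1 := h _ ⟨n, hn, rfl⟩ ((znorm n : ℂ)⁻¹ * lam) (by
      rw [← Complex.ofReal_inv, Complex.re_ofReal_mul, ← div_eq_inv_mul, le_div_iff₀ hN]
      exact hlam)
    rwa [← Lam_eq_dispersion _ hn, mul_inv_cancel_left₀ hNc] at h1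
  refine exists_pos_le_norm_sub_of_forall_ne (K := Metric.closedBall 0 M ×ˢ Metric.closedBall 0 1)
    ((isCompact_closedBall _ _).prod (isCompact_closedBall _ _)) ?_ hγ₀ hγ I_ne_zero ?_ ?_ ?_ ?_
  · rintro _ ⟨n, hn, rfl⟩
    refine ⟨by simpa using hP n, ?_⟩
    rw [mem_closedBall_zero_iff]
    refine (pi_norm_le_iff_of_nonneg zero_le_one).2 fun j => ?_
    rw [norm_div, Real.norm_eq_abs, Real.norm_eq_abs, abs_of_pos (znorm_pos hn)]
    exact (div_le_one (znorm_pos hn)).2 (abs_le_znorm n j)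
  · intro θ ν hν
    have h1 : ContinuousAt (fun q : (((Fin m → ℂ) →L[ℂ] ℂ) × (Fin d → ℝ)) × ℂ =>
        Function.uncurry (dispersionVec μ Φ) (q.1.2, q.2)) (θ, ν) :=
      ContinuousAt.comp (f := fun q : (((Fin m → ℂ) →L[ℂ] ℂ) × (Fin d → ℝ)) × ℂ => (q.1.2, q.2))
        (x := (θ, ν)) (continuousAt_dispersionVec hΦ hDΦ θ.2 hν)
        (Continuous.continuousAt (by fun_prop))
    have h2 : ContinuousAt (fun q : (((Fin m → ℂ) →L[ℂ] ℂ) × (Fin d → ℝ)) × ℂ => q.1.1) (θ, ν) :=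
      Continuous.continuousAt (by fun_prop)
    exact continuousAt_const.mul (h2.clm_apply h1)
  · intro θ ν hν
    have h1 : DifferentiableAt ℂ (dispersionVec μ Φ θ.2) ν :=
      differentiableAt_imagResolvent (by fun_prop)
        ((hDΦ.apply_continuousLinearMap θ.2).smul (-I)) hΦ.neg hν
    exact (θ.1.differentiableAt.comp ν h1).const_mul I
  · intro θ ν hθ hν hinf
    have h1 := tendsto_dispersionVec hΦ hDΦ hγpos (e := fun k => (θ k).2)
      (fun k => by simpa using (hθ k).2) hν hinf
    have h2 : Tendsto (fun k => M * ‖dispersionVec μ Φ (θ k).2 (ν k)‖) atTop (𝓝 0) := by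
      simpa using h1.norm.const_mul M
    refine squeeze_zero_norm (fun k => ?_) h2
    rw [dispersion, norm_mul, Complex.norm_I, one_mul]
    refine (ContinuousLinearMap.le_opNorm _ _).trans ?_
    gcongr
    simpa using (hθ k).1
  · rintro _ ⟨n, hn, rfl⟩ ν hν
    rw [← Lam_eq_dispersion _ hn]
    refine hstab n hn _ ?_
    rw [Complex.re_ofReal_mul, mul_comm]
    exact mul_lt_mul_of_pos_left hν (znorm_pos hn)

end

section

variable {X : Type*} [MeasurableSpace X]

section
variable {μ : Measure X} {a : X → ℝ} {k₀ k₁ : X → ℂ}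

theorem integrable_wave_integrand_mul [SFinite μ] (ha : Measurable a) (hk₀ : Integrable k₀ μ)
    (hk₁ : Integrable k₁ μ) {y : ℝ → ℂ} (hym : Measurable y) {t B : ℝ}
    (hyb : ∀ s, 0 ≤ s → s ≤ t → ‖y s‖ ≤ B) :
    Integrable (fun p : ℝ × X => Complex.exp (-I * (t - p.1 : ℝ) * a p.2)
      * (k₀ p.2 + (t - p.1 : ℝ) * k₁ p.2) * y p.1) ((volume.restrict (Ioc 0 t)).prod μ) := by
  have hfin : IsFiniteMeasure (volume.restrict (Ioc (0 : ℝ) t)) := ⟨by simp⟩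
  have hdom : Integrable (fun p : ℝ × X => (‖k₀ p.2‖ + t * ‖k₁ p.2‖) * B)
      ((volume.restrict (Ioc 0 t)).prod μ) :=
    ((hk₀.norm.add (hk₁.norm.const_mul t)).mul_const B).comp_snd _
  refine hdom.mono' ?_ ?_
  · have h1 : Measurable fun p : ℝ × X => Complex.exp (-I * (t - p.1 : ℝ) * a p.2) := by fun_prop
    have h2 : Measurable fun p : ℝ × X => ((t - p.1 : ℝ) : ℂ) := by fun_prop
    exact (h1.aestronglyMeasurable.mul (hk₀.aestronglyMeasurable.comp_snd.add
      (h2.aestronglyMeasurable.mul hk₁.aestronglyMeasurable.comp_snd))).mul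
      (hym.comp measurable_fst).aestronglyMeasurable
  · have hae : ∀ᵐ p : ℝ × X ∂((volume.restrict (Ioc 0 t)).prod μ), p.1 ∈ Ioc 0 t :=
      Measure.quasiMeasurePreserving_fst.ae (ae_restrict_mem measurableSet_Ioc)
    filter_upwards [hae] with p hp
    rw [norm_mul]
    refine mul_le_mul ((norm_wave_integrand_le _ _ _ _).trans ?_) (hyb _ hp.1.le hp.2)
      (norm_nonneg _) ?_
    · rw [abs_of_nonneg (sub_nonneg.2 hp.2)]
      gcongr
      linarith [hp.1]
    · have : 0 ≤ t := hp.1.le.trans hp.2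
      positivity

/-- Fubini for a superposition of oscillatory Duhamel integrals. -/
theorem integral_duhamel_swap [SFinite μ] (ha : Measurable a) (hk₀ : Integrable k₀ μ)
    (hk₁ : Integrable k₁ μ) {y : ℝ → ℂ} (hym : Measurable y) {t B : ℝ} (ht : 0 ≤ t)
    (hyb : ∀ s, 0 ≤ s → s ≤ t → ‖y s‖ ≤ B) :
    Integrable (fun x => ∫ s in (0 : ℝ)..t, Complex.exp (-I * (t - s : ℝ) * a x)
      * (k₀ x + (t - s : ℝ) * k₁ x) * y s) μ ∧
    ∫ x, (∫ s in (0 : ℝ)..t, Complex.exp (-I * (t - s : ℝ) * a x)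
      * (k₀ x + (t - s : ℝ) * k₁ x) * y s) ∂μ
      = ∫ s in (0 : ℝ)..t, waveTransform μ a k₀ k₁ (t - s) * y s := by
  have hI_int := integrable_wave_integrand_mul ha hk₀ hk₁ hym hyb
  simp only [intervalIntegral.integral_of_le ht]
  refine ⟨hI_int.integral_prod_right, ?_⟩
  rw [← integral_integral_swap hI_int]
  refine integral_congr_ae (Eventually.of_forall fun s => ?_)
  exact integral_mul_const _ _

end

section
variable {ι : Type*} [Fintype ι] {μ : Measure X} {a : X → ℝ} {φ : X → ℂ} {ψ : ι → X → ℂ}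

theorem norm_observable_le {φ α : ℂ} {ψ β : ι → ℂ} {B : ℝ} (hα : ‖α‖ ≤ B) (hβ : ‖β‖ ≤ B) :
    ‖α * φ + ∑ j, β j * ψ j‖ ≤ B * (‖φ‖ + ∑ j, ‖ψ j‖) := by
  rw [mul_add, Finset.mul_sum]
  refine (norm_add_le _ _).trans (add_le_add ?_ ((norm_sum_le _ _).trans
    (Finset.sum_le_sum fun j _ => ?_)))
  · rw [norm_mul]; gcongr
  · rw [norm_mul]; gcongr; exact (norm_le_pi_norm β j).trans hβ

theorem norm_sum_mul_le {ν β : ι → ℂ} {N B : ℝ} (hν : ∀ j, ‖ν j‖ ≤ N) (hβ : ∀ j, ‖β j‖ ≤ B)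
    (hN : 0 ≤ N) : ‖∑ j, ν j * β j‖ ≤ Fintype.card ι * (N * B) := by
  refine (norm_sum_le _ _).trans ?_
  rw [← nsmul_eq_mul, ← Finset.card_univ]
  refine Finset.sum_le_card_nsmul _ _ _ fun j _ => ?_
  rw [norm_mul]
  exact mul_le_mul (hν j) (hβ j) (norm_nonneg _) hN

/-- Integrability of the observable of bounded fields. -/
theorem integrable_observable (hφ : Integrable φ μ) (hψ : ∀ j, Integrable (ψ j) μ)
    {α : X → ℂ} {β : X → ι → ℂ} (hα : Measurable α) (hβ : Measurable β) {B : ℝ}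
    (hB : ∀ᵐ x ∂μ, ‖α x‖ ≤ B ∧ ‖β x‖ ≤ B) :
    Integrable (fun x => α x * φ x + ∑ j, β x j * ψ j x) μ := by
  refine Integrable.mono' (g := fun x => B * (‖φ x‖ + ∑ j, ‖ψ j x‖)) ?_ ?_ ?_
  · exact (hφ.norm.add (integrable_finsetSum _ fun j _ => (hψ j).norm)).const_mul B
  · refine (hα.aestronglyMeasurable.mul hφ.aestronglyMeasurable).add ?_
    refine Finset.aestronglyMeasurable_fun_sum _ fun j _ => ?_
    exact (hβ.eval (a := j)).aestronglyMeasurable.mul (hψ j).aestronglyMeasurable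
  · filter_upwards [hB] with x hx
    exact norm_observable_le hx.1 hx.2

theorem norm_integral_observable_le (hφ : Integrable φ μ) (hψ : ∀ j, Integrable (ψ j) μ)
    {α : X → ℂ} {β : X → ι → ℂ} {B : ℝ} (hB : ∀ᵐ x ∂μ, ‖α x‖ ≤ B ∧ ‖β x‖ ≤ B) :
    ‖∫ x, α x * φ x + ∑ j, β x j * ψ j x ∂μ‖ ≤ ∫ x, B * (‖φ x‖ + ∑ j, ‖ψ j x‖) ∂μ := by
  refine norm_integral_le_of_norm_le ?_ ?_
  · exact (hφ.norm.add (integrable_finsetSum _ fun j _ => (hψ j).norm)).const_mul B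
  · filter_upwards [hB] with x hx
    exact norm_observable_le hx.1 hx.2

theorem measurable_integral_observable [SFinite μ] (hφ : Measurable φ)
    (hψ : ∀ j, Measurable (ψ j)) {α : ℝ → X → ℂ} {β : ℝ → X → ι → ℂ}
    (hα : Measurable (Function.uncurry α)) (hβ : Measurable (Function.uncurry β)) :
    Measurable fun s => ∫ x, α s x * φ x + ∑ j, β s x j * ψ j x ∂μ := by
  refine (StronglyMeasurable.integral_prod_right (Measurable.stronglyMeasurable ?_)).measurable
  refine (hα.mul (hφ.comp measurable_snd)).add ?_
  refine Finset.measurable_fun_sum _ fun j _ => ?_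
  exact (hβ.eval (a := j)).mul ((hψ j).comp measurable_snd)

/-- The observable of a mild solution solves a scalar Volterra equation. -/
theorem volterra_of_duhamel [SFinite μ] (ha : Measurable a)
    (hφ : Integrable φ μ) (hψ : ∀ j, Integrable (ψ j) μ)
    {ν : ι → ℂ} {N : ℂ} {y : ℝ → ℂ} (hym : Measurable y) {t C : ℝ} (ht : 0 ≤ t)
    (hyb : ∀ s, 0 ≤ s → s ≤ t → ‖y s‖ ≤ C)
    {α α₀ : X → ℂ} {β β₀ : X → ι → ℂ} (hα₀ : Measurable α₀) (hβ₀ : Measurable β₀) {B : ℝ}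
    (hB : ∀ᵐ x ∂μ, ‖α₀ x‖ ≤ B ∧ ‖β₀ x‖ ≤ B)
    (hduh : ∀ᵐ x ∂μ,
      (α x = Complex.exp (-Complex.I * (t : ℂ) * (a x : ℂ))
          * (α₀ x - Complex.I * (t : ℂ) * ∑ j, ν j * β₀ x j)
        - N ^ 2 * ∫ s in (0 : ℝ)..t, ((t - s : ℝ) : ℂ)
              * Complex.exp (-Complex.I * ((t - s : ℝ) : ℂ) * (a x : ℂ)) * y s)
      ∧ ∀ j, β x j = Complex.exp (-Complex.I * (t : ℂ) * (a x : ℂ)) * β₀ x j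
        - Complex.I * ν j * ∫ s in (0 : ℝ)..t,
              Complex.exp (-Complex.I * ((t - s : ℝ) : ℂ) * (a x : ℂ)) * y s) :
    ∫ x, α x * φ x + ∑ j, β x j * ψ j x ∂μ
      = waveTransform μ a (fun x => α₀ x * φ x + ∑ j, β₀ x j * ψ j x)
          (fun x => -I * (∑ j, ν j * β₀ x j) * φ x) t
        + ∫ s in (0 : ℝ)..t, waveTransform μ a (fun x => -I * ∑ j, ν j * ψ j x)
          (fun x => -N ^ 2 * φ x) (t - s) * y s := by
  have hf₀ := integrable_observable hφ hψ hα₀ hβ₀ hB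
  have hf₁ : Integrable (fun x => -I * (∑ j, ν j * β₀ x j) * φ x) μ := by
    have hm : Measurable fun x => -I * ∑ j, ν j * β₀ x j := by fun_prop
    refine hφ.bdd_mul (c := ∑ j, ‖ν j‖ * B) hm.aestronglyMeasurable ?_
    filter_upwards [hB] with x hx
    rw [norm_mul, norm_neg, Complex.norm_I, one_mul]
    refine (norm_sum_le _ _).trans (Finset.sum_le_sum fun j _ => ?_)
    rw [norm_mul]
    gcongr
    exact (norm_le_pi_norm _ j).trans hx.2
  have hk₀ : Integrable (fun x => -I * ∑ j, ν j * ψ j x) μ :=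
    (integrable_finsetSum _ fun j _ => (hψ j).const_mul (ν j)).const_mul (-I)
  have hk₁ : Integrable (fun x => -N ^ 2 * φ x) μ := hφ.const_mul _
  obtain ⟨hi, hswap⟩ := integral_duhamel_swap ha hk₀ hk₁ hym ht hyb
  have hw : Integrable (fun x => Complex.exp (-I * t * a x) *
      ((α₀ x * φ x + ∑ j, β₀ x j * ψ j x) + t * (-I * (∑ j, ν j * β₀ x j) * φ x))) μ := by
    refine ((hf₀.norm.add (hf₁.norm.const_mul |t|)).mono'
      (aestronglyMeasurable_wave_integrand ha hf₀.aestronglyMeasurable hf₁.aestronglyMeasurable t)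
      (Eventually.of_forall fun x => norm_wave_integrand_le _ _ _ _))
  rw [← hswap, waveTransform, ← integral_add hw hi]
  have hyI : IntervalIntegrable y volume 0 t := by
    rw [intervalIntegrable_iff_integrableOn_Ioc_of_le ht]
    refine Measure.integrableOn_of_bounded (M := C) (by simp) hym.aestronglyMeasurable ?_
    filter_upwards [ae_restrict_mem measurableSet_Ioc] with s hs
    exact hyb s hs.1.le hs.2
  refine integral_congr_ae ?_
  filter_upwards [hduh] with x hx
  have e0 : IntervalIntegrable (fun s : ℝ => Complex.exp (-I * ((t - s : ℝ) : ℂ) * (a x : ℂ)) * y s)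
      volume 0 t :=
    hyI.continuousOn_mul (Continuous.continuousOn (by fun_prop))
  have e1 : IntervalIntegrable (fun s : ℝ => ((t - s : ℝ) : ℂ) *
      Complex.exp (-I * ((t - s : ℝ) : ℂ) * (a x : ℂ)) * y s) volume 0 t :=
    hyI.continuousOn_mul (Continuous.continuousOn (by fun_prop))
  have e2 : ∫ s in (0 : ℝ)..t, Complex.exp (-I * (t - s : ℝ) * a x)
      * (-I * ∑ j, ν j * ψ j x + (t - s : ℝ) * (-N ^ 2 * φ x)) * y s
      = (-I * ∑ j, ν j * ψ j x) * (∫ s in (0 : ℝ)..t,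
          Complex.exp (-I * ((t - s : ℝ) : ℂ) * (a x : ℂ)) * y s)
        + (-N ^ 2 * φ x) * ∫ s in (0 : ℝ)..t, ((t - s : ℝ) : ℂ) *
          Complex.exp (-I * ((t - s : ℝ) : ℂ) * (a x : ℂ)) * y s := by
    rw [← intervalIntegral.integral_const_mul, ← intervalIntegral.integral_const_mul,
      ← intervalIntegral.integral_add (e0.const_mul _) (e1.const_mul _)]
    refine intervalIntegral.integral_congr fun s _ => ?_
    ring
  rw [e2, hx.1]
  set E := Complex.exp (-I * t * a x)
  set J := ∫ s in (0 : ℝ)..t, Complex.exp (-I * ((t - s : ℝ) : ℂ) * (a x : ℂ)) * y s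
  set J' := ∫ s in (0 : ℝ)..t, ((t - s : ℝ) : ℂ) *
          Complex.exp (-I * ((t - s : ℝ) : ℂ) * (a x : ℂ)) * y s
  have e3 : ∑ j, β x j * ψ j x = E * ∑ j, β₀ x j * ψ j x - I * J * ∑ j, ν j * ψ j x := by
    rw [Finset.mul_sum, Finset.mul_sum, ← Finset.sum_sub_distrib]
    refine Finset.sum_congr rfl fun j _ => ?_
    rw [hx.2 j]
    ring
  rw [e3]
  ring

end

end

section

variable {X : Type*} [MeasurableSpace X]

section
variable {ι : Type*} [Fintype ι] {μ : Measure X} {a : X → ℝ} {φ : X → ℂ} {ψ : ι → X → ℂ}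

/-- Growth constant of the scalar observable of one mode. -/
def observableConst (D A γ c : ℝ) : ℝ :=
  A * (1 + D + D / γ) * (1 + (2 * c * γ)⁻¹ * (A * (D + 1 / γ)))

/-- Growth constant of one mode. -/
def modeConst (D A γ c : ℝ) : ℝ :=
  1 + D / γ + observableConst D A γ c / γ ^ 2 + observableConst D A γ c / γ

theorem observableConst_nonneg {D A γ c : ℝ} (hD : 0 ≤ D) (hA : 0 ≤ A) (hγ : 0 < γ) (hc : 0 < c) :
    0 ≤ observableConst D A γ c := by
  unfold observableConst; positivity

theorem one_le_modeConst {D A γ c : ℝ} (hD : 0 ≤ D) (hA : 0 ≤ A) (hγ : 0 < γ) (hc : 0 < c) :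
    1 ≤ modeConst D A γ c := by
  have := observableConst_nonneg hD hA hγ hc
  have h1 : 0 ≤ D / γ + observableConst D A γ c / γ ^ 2 + observableConst D A γ c / γ := by
    positivity
  unfold modeConst; linarith

theorem integral_sum_norm_le (hψ : ∀ j, Integrable (ψ j) μ) {A : ℝ}
    (hψA : ∀ j, ∫ x, ‖ψ j x‖ ∂μ ≤ A) : ∫ x, ∑ j, ‖ψ j x‖ ∂μ ≤ Fintype.card ι * A := by
  rw [integral_finsetSum _ fun j _ => (hψ j).norm, ← nsmul_eq_mul, ← Finset.card_univ]
  exact Finset.sum_le_card_nsmul _ _ _ fun j _ => hψA j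

/-- A solution of the scalar equation of one mode grows at most like `e^{γNt}`. -/
theorem observable_norm_le [SFinite μ] (ha : Measurable a)
    (hφ : Integrable φ μ) (hψ : ∀ j, Integrable (ψ j) μ) {A : ℝ}
    (hφA : ∫ x, ‖φ x‖ ∂μ ≤ A) (hψA : ∀ j, ∫ x, ‖ψ j x‖ ∂μ ≤ A)
    {ν : ι → ℂ} {N γ c : ℝ} (hN : 0 < N) (hν : ∀ j, ‖ν j‖ ≤ N) (hγ : 0 < γ) (hc : 0 < c)
    (hlow : ∀ z : ℂ, γ * N ≤ z.re → c ≤ ‖1 - imagResolvent μ a (fun x => -I * ∑ j, ν j * ψ j x)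
      (fun x => -(N : ℂ) ^ 2 * φ x) z‖)
    {y : ℝ → ℂ} (hym : Measurable y)
    (hyb : ∀ T : ℝ, 0 < T → ∃ B, ∀ t, 0 ≤ t → t ≤ T → ‖y t‖ ≤ B)
    {α₀ : X → ℂ} {β₀ : X → ι → ℂ} (hα₀ : Measurable α₀) (hβ₀ : Measurable β₀) {B : ℝ}
    (hB0 : 0 ≤ B) (hB : ∀ᵐ x ∂μ, ‖α₀ x‖ ≤ B ∧ ‖β₀ x‖ ≤ B)
    (hy : ∀ t, 0 ≤ t → y t = waveTransform μ a (fun x => α₀ x * φ x + ∑ j, β₀ x j * ψ j x)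
          (fun x => -I * (∑ j, ν j * β₀ x j) * φ x) t
        + ∫ s in (0 : ℝ)..t, waveTransform μ a (fun x => -I * ∑ j, ν j * ψ j x)
          (fun x => -(N : ℂ) ^ 2 * φ x) (t - s) * y s) {t : ℝ} (ht : 0 ≤ t) :
    ‖y t‖ ≤ observableConst (Fintype.card ι) A γ c * (B * Real.exp (γ * N * t)) := by
  set D : ℝ := (Fintype.card ι : ℝ) with hD
  have hD0 : 0 ≤ D := Nat.cast_nonneg _
  have hA : 0 ≤ A := (integral_nonneg fun _ => norm_nonneg _).trans hφA
  have hσ : 0 < γ * N := mul_pos hγ hN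
  have hS : Integrable (fun x => ∑ j, ‖ψ j x‖) μ := integrable_finsetSum _ fun j _ => (hψ j).norm
  have hSA : ∫ x, ∑ j, ‖ψ j x‖ ∂μ ≤ D * A := integral_sum_norm_le hψ hψA
  have hf₀ := integrable_observable hφ hψ hα₀ hβ₀ hB
  have hf₁b : ∀ᵐ x ∂μ, ‖-I * ∑ j, ν j * β₀ x j‖ ≤ D * (N * B) := by
    filter_upwards [hB] with x hx
    rw [norm_mul, norm_neg, Complex.norm_I, one_mul]
    exact norm_sum_mul_le hν (fun j => (norm_le_pi_norm _ j).trans hx.2) hN.le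
  have hf₁ : Integrable (fun x => -I * (∑ j, ν j * β₀ x j) * φ x) μ :=
    hφ.bdd_mul (c := D * (N * B)) (show Measurable fun x => -I * ∑ j, ν j * β₀ x j by
      fun_prop).aestronglyMeasurable hf₁b
  have hk₀ : Integrable (fun x => -I * ∑ j, ν j * ψ j x) μ :=
    (integrable_finsetSum _ fun j _ => (hψ j).const_mul (ν j)).const_mul (-I)
  have hk₁ : Integrable (fun x => -(N : ℂ) ^ 2 * φ x) μ := hφ.const_mul _
  have ek₀ : ∫ x, ‖-I * ∑ j, ν j * ψ j x‖ ∂μ ≤ N * (D * A) := by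
    calc _ ≤ ∫ x, N * ∑ j, ‖ψ j x‖ ∂μ := by
          refine integral_mono hk₀.norm (hS.const_mul N) fun x => ?_
          dsimp only
          rw [norm_mul, norm_neg, Complex.norm_I, one_mul, Finset.mul_sum]
          refine (norm_sum_le _ _).trans (Finset.sum_le_sum fun j _ => ?_)
          rw [norm_mul]
          gcongr
          exact hν j
      _ ≤ N * (D * A) := by rw [integral_const_mul]; gcongr
  have ek₁ : ∫ x, ‖-(N : ℂ) ^ 2 * φ x‖ ∂μ ≤ N ^ 2 * A := by
    have : ∀ x, ‖-(N : ℂ) ^ 2 * φ x‖ = N ^ 2 * ‖φ x‖ := fun x => by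
      rw [norm_mul, norm_neg, norm_pow, Complex.norm_real, Real.norm_eq_abs, sq_abs]
    simp_rw [this]
    rw [integral_const_mul]
    gcongr
  have ef₀ : ∫ x, ‖α₀ x * φ x + ∑ j, β₀ x j * ψ j x‖ ∂μ ≤ B * (A + D * A) := by
    calc _ ≤ ∫ x, B * (‖φ x‖ + ∑ j, ‖ψ j x‖) ∂μ := by
          refine integral_mono_ae hf₀.norm ((hφ.norm.add hS).const_mul B) ?_
          filter_upwards [hB] with x hx
          exact norm_observable_le hx.1 hx.2
      _ ≤ B * (A + D * A) := by
          rw [integral_const_mul, integral_add hφ.norm hS]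
          gcongr
  have ef₁ : ∫ x, ‖-I * (∑ j, ν j * β₀ x j) * φ x‖ ∂μ ≤ D * (N * B) * A := by
    calc _ ≤ ∫ x, D * (N * B) * ‖φ x‖ ∂μ := by
          refine integral_mono_ae hf₁.norm (hφ.norm.const_mul _) ?_
          filter_upwards [hf₁b] with x hx
          rw [norm_mul]
          gcongr
      _ ≤ D * (N * B) * A := by
          rw [integral_const_mul]
          gcongr
  have hk : ∫ x, (‖-I * ∑ j, ν j * ψ j x‖ + ‖-(N : ℂ) ^ 2 * φ x‖ / (γ * N)) ∂μ
      ≤ N * (A * (D + 1 / γ)) := by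
    rw [integral_add hk₀.norm (hk₁.norm.div_const _), integral_div]
    calc _ ≤ N * (D * A) + N ^ 2 * A / (γ * N) := by gcongr
      _ = _ := by field_simp
  have hf : ∫ x, ‖α₀ x * φ x + ∑ j, β₀ x j * ψ j x‖ ∂μ
      + (∫ x, ‖-I * (∑ j, ν j * β₀ x j) * φ x‖ ∂μ) / (γ * N) ≤ A * (1 + D + D / γ) * B := by
    calc _ ≤ B * (A + D * A) + D * (N * B) * A / (γ * N) := by gcongr
      _ = _ := by field_simp
  have hmain := volterra_sub_norm_le ha hk₀ hk₁ hf₀ hf₁ hσ hc hlow hym hyb hy ht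
  rw [integral_add hf₀.norm (hf₁.norm.div_const _), integral_div] at hmain
  have hf' : 0 ≤ ∫ x, ‖α₀ x * φ x + ∑ j, β₀ x j * ψ j x‖ ∂μ :=
    integral_nonneg fun _ => norm_nonneg _
  have hf'' : 0 ≤ ∫ x, ‖-I * (∑ j, ν j * β₀ x j) * φ x‖ ∂μ :=
    integral_nonneg fun _ => norm_nonneg _
  have hF := norm_waveTransform_le (a := a) hf₀ hf₁ t
  rw [abs_of_nonneg ht] at hF
  replace hF := hF.trans (add_mul_le_exp hσ ht hf' hf'')
  calc ‖y t‖ ≤ _ + _ := norm_le_norm_sub_add _ _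
    _ ≤ (2 * c * (γ * N))⁻¹ * ((N * (A * (D + 1 / γ))) * (A * (1 + D + D / γ) * B))
          * Real.exp (γ * N * t) + A * (1 + D + D / γ) * B * Real.exp (γ * N * t) := by
        refine add_le_add (hmain.trans ?_) (hF.trans ?_)
        · gcongr
        · gcongr
    _ = _ := by
        unfold observableConst
        field_simp
        ring

/-- Exponential growth bound for a single mode. -/
theorem mode_norm_le [SFinite μ] (ha : Measurable a)
    (hφm : Measurable φ) (hψm : ∀ j, Measurable (ψ j))
    (hφ : Integrable φ μ) (hψ : ∀ j, Integrable (ψ j) μ) {A : ℝ}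
    (hφA : ∫ x, ‖φ x‖ ∂μ ≤ A) (hψA : ∀ j, ∫ x, ‖ψ j x‖ ∂μ ≤ A)
    {ν : ι → ℂ} {N γ c : ℝ} (hN : 0 < N) (hν : ∀ j, ‖ν j‖ ≤ N) (hγ : 0 < γ) (hc : 0 < c)
    (hlow : ∀ z : ℂ, γ * N ≤ z.re → c ≤ ‖1 - imagResolvent μ a (fun x => -I * ∑ j, ν j * ψ j x)
      (fun x => -(N : ℂ) ^ 2 * φ x) z‖)
    {α : ℝ → X → ℂ} {β : ℝ → X → ι → ℂ} (hα : Measurable (Function.uncurry α))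
    (hβ : Measurable (Function.uncurry β))
    (hbdd : ∀ T > (0 : ℝ), ∃ B : ℝ, ∀ t ∈ Icc (0 : ℝ) T,
      ∀ᵐ x ∂μ, ‖α t x‖ ≤ B ∧ ‖β t x‖ ≤ B)
    {B : ℝ} (hB0 : 0 ≤ B) (hB : ∀ᵐ x ∂μ, ‖α 0 x‖ ≤ B ∧ ‖β 0 x‖ ≤ B)
    {y : ℝ → ℂ} (hydef : ∀ s, 0 ≤ s → y s = ∫ x, α s x * φ x + ∑ j, β s x j * ψ j x ∂μ)
    (hduh : ∀ t : ℝ, 0 ≤ t → ∀ᵐ x ∂μ,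
      (α t x = Complex.exp (-Complex.I * (t : ℂ) * (a x : ℂ))
          * (α 0 x - Complex.I * (t : ℂ) * ∑ j, ν j * β 0 x j)
        - (N : ℂ) ^ 2 * ∫ s in (0 : ℝ)..t, ((t - s : ℝ) : ℂ)
              * Complex.exp (-Complex.I * ((t - s : ℝ) : ℂ) * (a x : ℂ)) * y s)
      ∧ ∀ j, β t x j = Complex.exp (-Complex.I * (t : ℂ) * (a x : ℂ)) * β 0 x j
        - Complex.I * ν j * ∫ s in (0 : ℝ)..t,
              Complex.exp (-Complex.I * ((t - s : ℝ) : ℂ) * (a x : ℂ)) * y s)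
    {t : ℝ} (ht : 0 ≤ t) :
    ∀ᵐ x ∂μ, ‖α t x‖ ≤ modeConst (Fintype.card ι) A γ c * (B * Real.exp (γ * N * t)) ∧
      ‖β t x‖ ≤ modeConst (Fintype.card ι) A γ c * (B * Real.exp (γ * N * t)) := by
  set D : ℝ := (Fintype.card ι : ℝ) with hD
  have hD0 : 0 ≤ D := Nat.cast_nonneg _
  have hA : 0 ≤ A := (integral_nonneg fun _ => norm_nonneg _).trans hφA
  have hσ : 0 < γ * N := mul_pos hγ hN
  set z : ℝ → ℂ := fun s => ∫ x, α s x * φ x + ∑ j, β s x j * ψ j x ∂μ with hz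
  have hzm : Measurable z := measurable_integral_observable hφm hψm hα hβ
  have hzb : ∀ T : ℝ, 0 < T → ∃ B, ∀ t, 0 ≤ t → t ≤ T → ‖z t‖ ≤ B := by
    intro T hT
    obtain ⟨B, hB⟩ := hbdd T hT
    exact ⟨_, fun t h0 hT => norm_integral_observable_le hφ hψ (hB t ⟨h0, hT⟩)⟩
  have hcongr : ∀ (g : ℝ → ℂ) (t : ℝ), 0 ≤ t →
      ∫ s in (0 : ℝ)..t, g s * y s = ∫ s in (0 : ℝ)..t, g s * z s := by
    intro g t ht
    refine intervalIntegral.integral_congr fun s hs => ?_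
    rw [uIcc_of_le ht] at hs
    rw [hydef s hs.1]
  have hα0 : Measurable (α 0) := hα.comp (measurable_const.prodMk measurable_id)
  have hβ0 : Measurable (β 0) := hβ.comp (measurable_const.prodMk measurable_id)
  have hvolt : ∀ t, 0 ≤ t → z t = waveTransform μ a (fun x => α 0 x * φ x + ∑ j, β 0 x j * ψ j x)
          (fun x => -I * (∑ j, ν j * β 0 x j) * φ x) t
        + ∫ s in (0 : ℝ)..t, waveTransform μ a (fun x => -I * ∑ j, ν j * ψ j x)
          (fun x => -(N : ℂ) ^ 2 * φ x) (t - s) * z s := by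
    intro t ht
    obtain ⟨C, hC⟩ := hzb (t + 1) (by linarith)
    refine volterra_of_duhamel ha hφ hψ hzm ht (fun s h0 h1 => hC s h0 (by linarith)) hα0 hβ0 hB ?_
    filter_upwards [hduh t ht] with x hx
    rw [hcongr _ t ht] at hx
    refine ⟨hx.1, fun j => ?_⟩
    rw [hx.2 j, hcongr _ t ht]
  have hzexp : ∀ s, 0 ≤ s → ‖y s‖ ≤ observableConst D A γ c * (B * Real.exp (γ * N * s)) :=
    fun s hs => by
      rw [hydef s hs]
      exact observable_norm_le ha hφ hψ hφA hψA hN hν hγ hc hlow hzm hzb hα0 hβ0 hB0 hB hvolt hs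
  set Q := observableConst D A γ c with hQ
  have hQ0 : 0 ≤ Q := observableConst_nonneg hD0 hA hγ hc
  have hexp : 0 ≤ B * Real.exp (γ * N * t) := by positivity
  filter_upwards [hduh t ht, hB] with x hx hBx
  constructor
  · rw [hx.1]
    have h1 : ‖∫ s in (0 : ℝ)..t, ((t - s : ℝ) : ℂ)
        * Complex.exp (-Complex.I * ((t - s : ℝ) : ℂ) * (a x : ℂ)) * y s‖
        ≤ (0 / (γ * N) + 1 / (γ * N) ^ 2) * (Q * B * Real.exp (γ * N * t)) := by
      refine norm_integral_le_exp hσ ht le_rfl zero_le_one (mul_nonneg hQ0 hB0) fun s h0 hs => ?_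
      rw [norm_mul, norm_mul, norm_cexp_neg_I_mul, Complex.norm_real, Real.norm_eq_abs,
        abs_of_nonneg (sub_nonneg.2 hs), mul_one, zero_add, mul_assoc Q]
      exact mul_le_mul_of_nonneg_left (hzexp s h0) (sub_nonneg.2 hs)
    have h2 : ‖α 0 x - Complex.I * (t : ℂ) * ∑ j, ν j * β 0 x j‖
        ≤ (B + D * (N * B) / (γ * N)) * Real.exp (γ * N * t) := by
      refine (norm_sub_le _ _).trans (le_trans (add_le_add hBx.1 ?_)
        (add_mul_le_exp hσ ht hB0 (B₁ := D * (N * B)) (by positivity)))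
      rw [norm_mul, norm_mul, Complex.norm_I, one_mul, Complex.norm_real, Real.norm_eq_abs,
        abs_of_nonneg ht]
      gcongr
      exact norm_sum_mul_le hν (fun j => (norm_le_pi_norm _ j).trans hBx.2) hN.le
    refine (norm_sub_le _ _).trans ?_
    rw [norm_mul, norm_cexp_neg_I_mul, one_mul, norm_mul, norm_pow, Complex.norm_real,
      Real.norm_eq_abs, sq_abs]
    calc _ ≤ (B + D * (N * B) / (γ * N)) * Real.exp (γ * N * t)
          + N ^ 2 * ((0 / (γ * N) + 1 / (γ * N) ^ 2) * (Q * B * Real.exp (γ * N * t))) := by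
          gcongr
      _ = (1 + D / γ + Q / γ ^ 2) * (B * Real.exp (γ * N * t)) := by
          field_simp
          ring
      _ ≤ _ := by
          gcongr
          unfold modeConst
          have : 0 ≤ Q / γ := by positivity
          linarith
  · have hmc : 0 ≤ modeConst D A γ c := zero_le_one.trans (one_le_modeConst hD0 hA hγ hc)
    refine (pi_norm_le_iff_of_nonneg (mul_nonneg hmc hexp)).2 fun j => ?_
    rw [hx.2 j]
    have h1 : ‖∫ s in (0 : ℝ)..t,
        Complex.exp (-Complex.I * ((t - s : ℝ) : ℂ) * (a x : ℂ)) * y s‖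
        ≤ (1 / (γ * N) + 0 / (γ * N) ^ 2) * (Q * B * Real.exp (γ * N * t)) := by
      refine norm_integral_le_exp hσ ht zero_le_one le_rfl (mul_nonneg hQ0 hB0) fun s h0 hs => ?_
      rw [norm_mul, norm_cexp_neg_I_mul, mul_zero, add_zero, mul_assoc Q]
      exact mul_le_mul_of_nonneg_left (hzexp s h0) zero_le_one
    refine (norm_sub_le _ _).trans ?_
    rw [norm_mul, norm_cexp_neg_I_mul, one_mul, norm_mul, norm_mul, Complex.norm_I, one_mul]
    have hone : 1 ≤ Real.exp (γ * N * t) := Real.one_le_exp (by positivity)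
    calc _ ≤ B * Real.exp (γ * N * t)
          + N * ((1 / (γ * N) + 0 / (γ * N) ^ 2) * (Q * B * Real.exp (γ * N * t))) := by
          refine add_le_add ?_ (mul_le_mul (hν j) h1 (norm_nonneg _) hN.le)
          exact ((norm_le_pi_norm _ j).trans hBx.2).trans (le_mul_of_one_le_right hB0 hone)
      _ = (1 + Q / γ) * (B * Real.exp (γ * N * t)) := by
          field_simp
          ring
      _ ≤ _ := by
          gcongr
          unfold modeConst
          have : 0 ≤ D / γ + Q / γ ^ 2 := by positivity
          linarith

end

end

section
variable {d m : ℕ} {μ : Measure (Fin d → ℝ)} {Φ : (Fin d → ℝ) → (Fin m → ℂ)}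

theorem measurable_zdot (n : Fin d → ℤ) : Measurable (zdot n) := by
  unfold zdot; fun_prop

theorem Lam_eq_imagResolvent (hΦ : Integrable Φ μ) (hDΦ : Integrable (fun w => fderiv ℝ Φ w) μ)
    (p : (Fin m → ℂ) →L[ℂ] ℂ) (n : Fin d → ℤ) {z : ℂ} (hz : 0 < z.re) :
    Lam μ Φ p n z = I * imagResolvent μ (zdot n)
      (fun w => -I * ∑ j, (n j : ℂ) * p (fderiv ℝ Φ w (Pi.single j 1)))
      (fun w => -(znorm n : ℂ) ^ 2 * p (Φ w)) z := by
  have hsq : ((∑ j, ((n j : ℝ)) ^ 2 : ℝ) : ℂ) = (znorm n : ℂ) ^ 2 := by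
    rw [← znorm_sq]; push_cast; rfl
  have hi := integrable_resolvent_integrand (μ := μ) (a := zdot n)
    (k₀ := fun w => (-I) • ∑ j, (n j : ℂ) • fderiv ℝ Φ w (Pi.single j 1))
    (k₁ := fun w => (-(znorm n : ℂ) ^ 2) • Φ w) (measurable_zdot n)
    (Integrable.fun_smul (-I) (integrable_finsetSum _ fun j _ =>
      (hDΦ.apply_continuousLinearMap (Pi.single j 1)).fun_smul (n j : ℂ)))
    (hΦ.fun_smul _) hz
  rw [Lam, imagResolvent]
  congr 1
  have he : ∀ w, (-(((∑ j, ((n j : ℝ)) ^ 2 : ℝ)) : ℂ) / (z + Complex.I * (zdot n w : ℂ)) ^ 2) • Φ w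
      + (-Complex.I / (z + Complex.I * (zdot n w : ℂ))) •
          (∑ j, (n j : ℂ) • fderiv ℝ Φ w (Pi.single j 1))
      = (z + I * zdot n w)⁻¹ • ((-I) • ∑ j, (n j : ℂ) • fderiv ℝ Φ w (Pi.single j 1))
        + ((z + I * zdot n w)⁻¹ ^ 2) • ((-(znorm n : ℂ) ^ 2) • Φ w) := by
    intro w
    rw [hsq, add_comm, smul_smul, smul_smul]
    congr 2
    · rw [div_eq_inv_mul]
    · rw [div_eq_inv_mul, inv_pow]
  simp_rw [he]
  rw [← ContinuousLinearMap.integral_comp_comm p hi]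
  refine integral_congr_ae (Eventually.of_forall fun w => ?_)
  simp [map_sum]

theorem Iobs_eq_integral (hΦ : Integrable Φ μ) (hDΦ : Integrable (fun w => fderiv ℝ Φ w) μ)
    (p : (Fin m → ℂ) →L[ℂ] ℂ) {α : (Fin d → ℝ) → ℂ} {β : (Fin d → ℝ) → (Fin d → ℂ)}
    (hα : Measurable α) (hβ : Measurable β) {B : ℝ} (hB : ∀ᵐ w ∂μ, ‖α w‖ ≤ B ∧ ‖β w‖ ≤ B) :
    Iobs μ Φ p α β
      = ∫ w, α w * p (Φ w) + ∑ j, β w j * p (fderiv ℝ Φ w (Pi.single j 1)) ∂μ := by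
  have hi : Integrable (fun w => α w • Φ w + ∑ j, β w j • fderiv ℝ Φ w (Pi.single j 1)) μ := by
    refine Integrable.add ?_ (integrable_finsetSum _ fun j _ => ?_)
    · exact hΦ.bdd_smul B hα.aestronglyMeasurable (hB.mono fun w hw => hw.1)
    · exact (hDΦ.apply_continuousLinearMap (Pi.single j 1)).bdd_smul B
        (hβ.eval (a := j)).aestronglyMeasurable
        (hB.mono fun w hw => (norm_le_pi_norm _ j).trans hw.2)
  rw [Iobs, ← ContinuousLinearMap.integral_comp_comm p hi]
  refine integral_congr_ae (Eventually.of_forall fun w => ?_)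
  simp [map_sum]

/-- Growth bound for the nonzero modes. -/
theorem IsMildSolution.norm_le [IsProbabilityMeasure μ] (hΦdiff : Differentiable ℝ Φ)
    (hΦ : Integrable Φ μ) (hDΦ : Integrable (fun w => fderiv ℝ Φ w) μ) {M : ℝ}
    (hΦM : ∫ w, ‖Φ w‖ ∂μ ≤ M) (hDΦM : ∫ w, ‖fderiv ℝ Φ w‖ ∂μ ≤ M)
    {p : (Fin m → ℂ) →L[ℂ] ℂ} (hp : ‖p‖ ≤ M) {n : Fin d → ℤ} (hn : n ≠ 0) {γ c : ℝ}
    (hγ : 0 < γ) (hc : 0 < c)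
    (hlow : ∀ lam : ℂ, γ * znorm n ≤ lam.re → c ≤ ‖I - Lam μ Φ p n lam‖)
    {α : ℝ → (Fin d → ℝ) → ℂ} {β : ℝ → (Fin d → ℝ) → (Fin d → ℂ)}
    (h : IsMildSolution μ Φ p n α β (α 0) (β 0)) {B : ℝ} (hB0 : 0 ≤ B)
    (hB : ∀ᵐ w ∂μ, ‖α 0 w‖ ≤ B ∧ ‖β 0 w‖ ≤ B) {t : ℝ} (ht : 0 ≤ t) :
    ∀ᵐ w ∂μ, ‖α t w‖ ≤ modeConst d (M * M) γ c * (B * Real.exp (γ * znorm n * t)) ∧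
      ‖β t w‖ ≤ modeConst d (M * M) γ c * (B * Real.exp (γ * znorm n * t)) := by
  obtain ⟨hα, hβ, hbdd, hduh⟩ := h
  have hM : 0 ≤ M := (norm_nonneg p).trans hp
  have hcomp : ∀ {f : (Fin d → ℝ) → (Fin m → ℂ)} {g : (Fin d → ℝ) → ℝ}, Integrable g μ →
      (∀ w, ‖f w‖ ≤ g w) → Integrable f μ → ∫ w, g w ∂μ ≤ M → ∫ w, ‖p (f w)‖ ∂μ ≤ M * M := by
    intro f g hg hfg hf hgM
    calc ∫ w, ‖p (f w)‖ ∂μ ≤ ∫ w, M * g w ∂μ :=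
          integral_mono (p.integrable_comp hf).norm (hg.const_mul M) fun w =>
            (p.le_opNorm _).trans (mul_le_mul hp (hfg w) (norm_nonneg _) hM)
      _ ≤ M * M := by rw [integral_const_mul]; gcongr
  have hsingle : ∀ j : Fin d, ‖(Pi.single j 1 : Fin d → ℝ)‖ = 1 := fun j => by
    rw [Pi.norm_single, norm_one]
  have hslice : ∀ s, Measurable (α s) ∧ Measurable (β s) := fun s =>
    ⟨hα.comp (measurable_const.prodMk measurable_id),
      hβ.comp (measurable_const.prodMk measurable_id)⟩
  have key := mode_norm_le (μ := μ) (a := zdot n) (φ := fun w => p (Φ w))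
    (ψ := fun j w => p (fderiv ℝ Φ w (Pi.single j 1))) (A := M * M) (ν := fun j => (n j : ℂ))
    (N := znorm n) (γ := γ) (c := c) (B := B) (α := α) (β := β) (t := t)
    (y := fun s => Iobs μ Φ p (α s) (β s))
    (measurable_zdot n) (p.continuous.comp hΦdiff.continuous).measurable
    (fun j => p.continuous.measurable.comp (measurable_fderiv_apply_const ℝ Φ _))
    (p.integrable_comp hΦ)
    (fun j => p.integrable_comp (hDΦ.apply_continuousLinearMap _))
    (hcomp hΦ.norm (fun _ => le_rfl) hΦ hΦM)
    (fun j => hcomp hDΦ.norm (fun w => ((fderiv ℝ Φ w).le_opNorm _).trans_eq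
      (by rw [hsingle, mul_one])) (hDΦ.apply_continuousLinearMap _) hDΦM)
    (znorm_pos hn)
    (fun j => by
      rw [← Complex.ofReal_intCast, Complex.norm_real, Real.norm_eq_abs]
      exact abs_le_znorm n j)
    hγ hc
    (fun z hz => by
      have hzpos : 0 < z.re := (mul_pos hγ (znorm_pos hn)).trans_le hz
      have h1 := hlow z hz
      rw [Lam_eq_imagResolvent hΦ hDΦ p n hzpos, ← mul_one_sub, norm_mul, Complex.norm_I,
        one_mul] at h1
      exact h1)
    hα hβ hbdd hB0 hB
    (fun s hs => by
      obtain ⟨C, hC⟩ := hbdd (s + 1) (by linarith)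
      exact Iobs_eq_integral hΦ hDΦ p (hslice s).1 (hslice s).2 (hC s ⟨hs, by linarith⟩))
    hduh ht
  simpa using key

/-- The zero mode is stationary. -/
theorem IsMildSolution.ae_eq_of_zero {p : (Fin m → ℂ) →L[ℂ] ℂ}
    {α : ℝ → (Fin d → ℝ) → ℂ} {β : ℝ → (Fin d → ℝ) → (Fin d → ℂ)}
    {α₀ : (Fin d → ℝ) → ℂ} {β₀ : (Fin d → ℝ) → (Fin d → ℂ)}
    (h : IsMildSolution μ Φ p 0 α β α₀ β₀) {t : ℝ} (ht : 0 ≤ t) :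
    ∀ᵐ w ∂μ, α t w = α₀ w ∧ β t w = β₀ w := by
  filter_upwards [h.2.2.2 t ht] with w hw
  refine ⟨?_, funext fun j => ?_⟩
  · rw [hw.1]; simp [znorm, zdot]
  · rw [hw.2 j]; simp [zdot]

theorem max_essSup_le {α : (Fin d → ℝ) → ℂ} {β : (Fin d → ℝ) → (Fin d → ℂ)} {R : ℝ}
    (h : ∀ᵐ w ∂μ, ‖α w‖ ≤ R ∧ ‖β w‖ ≤ R) :
    max (essSup (fun w => (‖α w‖₊ : ℝ≥0∞)) μ) (essSup (fun w => (‖β w‖₊ : ℝ≥0∞)) μ)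
      ≤ ENNReal.ofReal R := by
  have hn : ∀ {F : Type} [NormedAddCommGroup F] {x : F}, ‖x‖ ≤ R →
      (‖x‖₊ : ℝ≥0∞) ≤ ENNReal.ofReal R :=
    fun {F} _ {x} hx => by
      rw [← enorm_eq_nnnorm, ← ofReal_norm]; exact ENNReal.ofReal_le_ofReal hx
  exact max_le (essSup_le_of_ae_le _ (h.mono fun w hw => hn hw.1))
    (essSup_le_of_ae_le _ (h.mono fun w hw => hn hw.2))

theorem ae_norm_le_toReal_max_essSup {α : (Fin d → ℝ) → ℂ} {β : (Fin d → ℝ) → (Fin d → ℂ)}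
    (h : max (essSup (fun w => (‖α w‖₊ : ℝ≥0∞)) μ) (essSup (fun w => (‖β w‖₊ : ℝ≥0∞)) μ) ≠ ⊤) :
    ∀ᵐ w ∂μ,
      ‖α w‖ ≤ (max (essSup (fun w => (‖α w‖₊ : ℝ≥0∞)) μ)
        (essSup (fun w => (‖β w‖₊ : ℝ≥0∞)) μ)).toReal ∧
      ‖β w‖ ≤ (max (essSup (fun w => (‖α w‖₊ : ℝ≥0∞)) μ)
        (essSup (fun w => (‖β w‖₊ : ℝ≥0∞)) μ)).toReal := by
  filter_upwards [ENNReal.ae_le_essSup (μ := μ) (fun w => (‖α w‖₊ : ℝ≥0∞)),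
    ENNReal.ae_le_essSup (μ := μ) (fun w => (‖β w‖₊ : ℝ≥0∞))] with w h1 h2
  exact ⟨by simpa using ENNReal.toReal_mono h (h1.trans (le_max_left _ _)),
    by simpa using ENNReal.toReal_mono h (h2.trans (le_max_right _ _))⟩

end

end

/-- Sharp semigroup bound for the linearized multiphasic system, mode by mode:
if `Λ_n(λ) ≠ i` whenever `n ≠ 0` and `Re λ > γ₀|n|`, then for every `γ > γ₀`
there is `C > 0` (independent of `δ₀` and of the data) such that any family of
mild solutions `(α_n, β_n)` whose data have finite weighted norm
`Σ_n max(‖α_n(0)‖_{L^∞}, ‖β_n(0)‖_{L^∞}) e^{δ₀|n|}` satisfies, for `0 ≤ t ≤ δ₀/γ`,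
`Σ_n max(‖α_n(t)‖_{L^∞}, ‖β_n(t)‖_{L^∞}) e^{(δ₀-γt)|n|} ≤ C Σ_n max(‖α_n(0)‖_{L^∞}, ‖β_n(0)‖_{L^∞}) e^{δ₀|n|}`. -/
theorem stmt_17 (d m : ℕ) (hd : 1 ≤ d) (hm : 1 ≤ m) (M : ℝ) (hM : 0 < M)
    (μ : Measure (Fin d → ℝ)) [IsProbabilityMeasure μ]
    (Φ : (Fin d → ℝ) → (Fin m → ℂ)) (hΦdiff : Differentiable ℝ Φ)
    (hΦint : Integrable Φ μ) (hΦM : ∫ w, ‖Φ w‖ ∂μ ≤ M)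
    (hDΦint : Integrable (fun w => fderiv ℝ Φ w) μ)
    (hDΦM : ∫ w, ‖fderiv ℝ Φ w‖ ∂μ ≤ M)
    (P : (Fin d → ℤ) → ((Fin m → ℂ) →L[ℂ] ℂ)) (hP : ∀ n, ‖P n‖ ≤ M)
    (γ₀ : ℝ) (hγ₀ : 0 ≤ γ₀)
    (hstab : ∀ n : Fin d → ℤ, n ≠ 0 → ∀ lam : ℂ,
      γ₀ * znorm n < lam.re → Lam μ Φ (P n) n lam ≠ Complex.I)
    (γ : ℝ) (hγ : γ₀ < γ) :
    ∃ C > (0 : ℝ), ∀ δ₀ > (0 : ℝ),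
      ∀ (α : (Fin d → ℤ) → ℝ → (Fin d → ℝ) → ℂ)
        (β : (Fin d → ℤ) → ℝ → (Fin d → ℝ) → (Fin d → ℂ)),
      (∀ n, IsMildSolution μ Φ (P n) n (α n) (β n) (α n 0) (β n 0)) →
      (∑' n : Fin d → ℤ,
          max (essSup (fun w => (‖α n 0 w‖₊ : ℝ≥0∞)) μ)
              (essSup (fun w => (‖β n 0 w‖₊ : ℝ≥0∞)) μ)
            * ENNReal.ofReal (Real.exp (δ₀ * znorm n)) ≠ ⊤) →
      ∀ t : ℝ, 0 ≤ t → t ≤ δ₀ / γ →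
        ∑' n : Fin d → ℤ,
            max (essSup (fun w => (‖α n t w‖₊ : ℝ≥0∞)) μ)
                (essSup (fun w => (‖β n t w‖₊ : ℝ≥0∞)) μ)
              * ENNReal.ofReal (Real.exp ((δ₀ - γ * t) * znorm n))
          ≤ ENNReal.ofReal C *
            ∑' n : Fin d → ℤ,
              max (essSup (fun w => (‖α n 0 w‖₊ : ℝ≥0∞)) μ)
                  (essSup (fun w => (‖β n 0 w‖₊ : ℝ≥0∞)) μ)
                * ENNReal.ofReal (Real.exp (δ₀ * znorm n)) := by
  have hγpos : 0 < γ := hγ₀.trans_lt hγ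
  obtain ⟨c, hc, hlow⟩ := exists_pos_le_norm_I_sub_Lam hΦint hDΦint hP hγ₀ hstab hγ
  have hC1 : 1 ≤ modeConst d (M * M) γ c :=
    one_le_modeConst (Nat.cast_nonneg d) (mul_nonneg hM.le hM.le) hγpos hc
  have hC0 : 0 < modeConst d (M * M) γ c := zero_lt_one.trans_le hC1
  refine ⟨modeConst d (M * M) γ c, hC0, fun δ₀ _ α β hsol _ t ht _ => ?_⟩
  rw [← ENNReal.tsum_mul_left]
  refine ENNReal.tsum_le_tsum fun n => ?_
  obtain ⟨B₁, hB₁⟩ := (hsol n).2.2.1 1 one_pos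
  set S := max (essSup (fun w => (‖α n 0 w‖₊ : ℝ≥0∞)) μ)
    (essSup (fun w => (‖β n 0 w‖₊ : ℝ≥0∞)) μ) with hS
  have hStop : S ≠ ⊤ :=
    ((max_essSup_le (hB₁ 0 ⟨le_rfl, zero_le_one⟩)).trans_lt ENNReal.ofReal_lt_top).ne
  have hB := ae_norm_le_toReal_max_essSup hStop
  have hgrow : ∀ᵐ w ∂μ,
      ‖α n t w‖ ≤ modeConst d (M * M) γ c * (S.toReal * Real.exp (γ * znorm n * t)) ∧
      ‖β n t w‖ ≤ modeConst d (M * M) γ c * (S.toReal * Real.exp (γ * znorm n * t)) := by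
    by_cases hn : n = 0
    · subst hn
      have hz : znorm (0 : Fin d → ℤ) = 0 := by simp [znorm]
      filter_upwards [(hsol 0).ae_eq_of_zero ht, hB] with w hw hBw
      rw [hz, mul_zero, zero_mul, Real.exp_zero, mul_one, hw.1, hw.2]
      have hle := le_mul_of_one_le_left (ENNReal.toReal_nonneg (a := S)) hC1
      exact ⟨hBw.1.trans hle, hBw.2.trans hle⟩
    · exact (hsol n).norm_le hΦdiff hΦint hDΦint hΦM hDΦM (hP n) hn hγpos hc (hlow n hn)
        ENNReal.toReal_nonneg hB ht
  calc _ ≤ ENNReal.ofReal (modeConst d (M * M) γ c * (S.toReal * Real.exp (γ * znorm n * t)))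
        * ENNReal.ofReal (Real.exp ((δ₀ - γ * t) * znorm n)) := by
        gcongr
        exact max_essSup_le hgrow
    _ = _ := by
        rw [← ENNReal.ofReal_toReal hStop, ← ENNReal.ofReal_mul ENNReal.toReal_nonneg,
          ← ENNReal.ofReal_mul hC0.le, ← ENNReal.ofReal_mul (by positivity),
          ENNReal.toReal_ofReal ENNReal.toReal_nonneg, mul_assoc, mul_assoc, ← Real.exp_add]
        congr 4
        ring_nf
end
end
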